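/- arXiv:1307.6893 — 2 statements merged into one kernel-verified Lean document; each statement's English description precedes it below -/
import Mathlib

section
/- Let G = SL(n,ℝ), Γ the image of SL(n,ℤ) in G, and let u : ℝ → G be a one-parameter unipotent subgroup. Then for every point a ∈ G/Γ, the orbit t ↦ u(t)·a does not diverge to infinity; that is, the map t ↦ u(t)·a from ℝ to G/Γ does not tend to the cocompact filter as t → +∞ (equivalently, there is a compact subset of G/Γ that u(t)·a visits for arbitrarily large t). -/
open Matrix MatrixGroups Filter

noncomputable instance {n : ℕ} : TopologicalSpace (Matrix.SpecialLinearGroup (Fin n) ℝ) :=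
  instTopologicalSpaceSubtype

/-- The image of `SL(n,ℤ)` in `SL(n,ℝ)`. -/
def SLZ (n : ℕ) : Subgroup (SL(n, ℝ)) :=
  (Matrix.SpecialLinearGroup.map (n := Fin n) (Int.castRingHom ℝ)).range

lemma remez (N : ℕ) (η : ℝ) (hη : 0 < η) : ∃ C : ℝ, 1 ≤ C ∧ ∀ p : Polynomial ℝ, p.natDegree ≤ N →
    ∀ a b c d M : ℝ, a ≤ c → d ≤ b → c < d → η * (b - a) ≤ d - c →
    (∀ y ∈ Set.Icc c d, |p.eval y| ≤ M) → ∀ y ∈ Set.Icc a b, |p.eval y| ≤ C * M := by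
  refine ⟨(N + 1) * ((N + 1) / η) ^ N + 1, by
    have : (0:ℝ) ≤ (N + 1) * ((N + 1) / η) ^ N := by positivity
    linarith, ?_⟩
  intro p hp a b c d M hac hdb hcd hη2 hM y hy
  have hN : (0:ℝ) < N + 1 := by positivity
  set v : ℕ → ℝ := fun i => c + (d - c) * (i / (N + 1)) with hv
  have hdiff : ∀ i j : ℕ, i ≠ j → (d - c) / (N + 1) ≤ |v i - v j| := by
    intro i j hij
    have h1 : v i - v j = (d - c) / (N + 1) * ((i : ℝ) - j) := by
      simp only [hv]; ring
    rw [h1, abs_mul, abs_of_pos (div_pos (sub_pos.2 hcd) hN)]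
    have h2 : (1:ℝ) ≤ |(i:ℝ) - j| := by
      have : (1:ℤ) ≤ |(i:ℤ) - j| := Int.one_le_abs (by omega)
      exact_mod_cast this
    nlinarith [div_pos (sub_pos.2 hcd) hN]
  have hinj : Set.InjOn v (Finset.range (N + 1)) := by
    intro i _ j _ hij
    by_contra h
    have := hdiff i j h
    rw [hij, sub_self, abs_zero] at this
    linarith [div_pos (sub_pos.2 hcd) hN]
  have hdeg : p.degree < (Finset.range (N + 1)).card := by
    rw [Finset.card_range]
    exact lt_of_le_of_lt Polynomial.degree_le_natDegree (by exact_mod_cast Nat.lt_succ_of_le hp)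
  have hmem : ∀ i ∈ Finset.range (N + 1), v i ∈ Set.Icc c d := by
    intro i hi
    rw [Finset.mem_range] at hi
    have h0 : (0:ℝ) ≤ (i:ℝ) / (N + 1) := by positivity
    have h1 : (i:ℝ) / (N + 1) ≤ 1 := by
      rw [div_le_one hN]; exact_mod_cast hi.le
    constructor <;> simp only [hv] <;> nlinarith
  have hM0 : 0 ≤ M := (abs_nonneg _).trans (hM c ⟨le_rfl, hcd.le⟩)
  have key := Lagrange.eq_interpolate hinj hdeg
  have h3 : p.eval y = ∑ i ∈ Finset.range (N + 1), p.eval (v i) *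
      ∏ j ∈ (Finset.range (N + 1)).erase i, ((v i - v j)⁻¹ * (y - v j)) := by
    conv_lhs => rw [key]
    simp [Lagrange.interpolate_apply, Polynomial.eval_finsetSum, Lagrange.basis,
      Polynomial.eval_prod, Lagrange.basisDivisor]
  have hb : ∀ i ∈ Finset.range (N + 1), |p.eval (v i) *
      ∏ j ∈ (Finset.range (N + 1)).erase i, ((v i - v j)⁻¹ * (y - v j))| ≤ M * ((N + 1) / η) ^ N := by
    intro i hi
    rw [abs_mul, Finset.abs_prod]
    refine mul_le_mul (hM _ (hmem i hi)) ?_ (by positivity) hM0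
    have hc : ((Finset.range (N + 1)).erase i).card = N := by
      rw [Finset.card_erase_of_mem hi, Finset.card_range]; simp
    calc _ ≤ ∏ j ∈ (Finset.range (N + 1)).erase i, (((N:ℝ) + 1) / η) := by
            refine Finset.prod_le_prod (fun _ _ => abs_nonneg _) ?_
            intro j hj
            obtain ⟨hji, hj⟩ := Finset.mem_erase.1 hj
            have h4 := hdiff i j hji.symm
            have h5 := hmem j hj
            have h6 : |y - v j| ≤ b - a := by
              rw [abs_le]; constructor <;> linarith [h5.1, h5.2, hy.1, hy.2]
            have h7 : 0 < (d - c) / (N + 1) := div_pos (sub_pos.2 hcd) hN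
            rw [abs_mul, abs_inv, inv_mul_le_iff₀ (by linarith)]
            calc |y - v j| ≤ b - a := h6
              _ ≤ (d - c) / η := by rw [le_div_iff₀ hη]; linarith
              _ = (d - c) / (N + 1) * ((N + 1) / η) := by field_simp
              _ ≤ _ := by gcongr
      _ = _ := by rw [Finset.prod_const, hc]
  rw [h3]
  calc _ ≤ ∑ i ∈ Finset.range (N + 1), M * (((N:ℝ) + 1) / η) ^ N :=
        (Finset.abs_sum_le_sum_abs _ _).trans (Finset.sum_le_sum hb)
    _ = (N + 1) * ((N + 1) / η) ^ N * M := by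
        rw [Finset.sum_const, Finset.card_range, nsmul_eq_mul]; push_cast; ring
    _ ≤ _ := by nlinarith

lemma poly_near (N : ℕ) : ∃ η : ℝ, 0 < η ∧ η ≤ 1 ∧ ∀ p : Polynomial ℝ, p.natDegree ≤ N →
    ∀ a b ρ : ℝ, a < b → 0 < ρ → (∀ y ∈ Set.Icc a b, 0 ≤ p.eval y ∧ p.eval y ≤ ρ) →
    p.eval b = ρ → ∀ y ∈ Set.Icc (b - η * (b - a)) b, ρ / 2 ≤ p.eval y := by
  obtain ⟨C, hC, hr⟩ := remez N (1/2) (by norm_num)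
  refine ⟨1 / (4 * C), by positivity, ?_, ?_⟩
  · rw [div_le_one (by positivity)]; linarith
  intro p hp a b ρ hab hρ hbd hpb y hy
  obtain ⟨q, hq⟩ := (Polynomial.dvd_iff_isRoot (p := p - Polynomial.C (p.eval b)) (a := b)).2
    (by simp)
  have hqe : ∀ z, p.eval z - p.eval b = (z - b) * q.eval z := by
    intro z
    have := congrArg (Polynomial.eval z) hq
    simpa using this
  have hqd : q.natDegree ≤ N := by
    by_cases h0 : q = 0
    · simp [h0]
    have h1 : (p - Polynomial.C (p.eval b)).natDegree ≤ N := by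
      rw [Polynomial.natDegree_sub_C]; exact hp
    rw [hq, Polynomial.natDegree_mul (Polynomial.X_sub_C_ne_zero b) h0] at h1
    omega
  have hm := hr q hqd a b a ((a + b) / 2) (2 * ρ / (b - a)) le_rfl (by linarith) (by linarith)
    (by linarith) (by
      intro z hz
      have hz' : z ∈ Set.Icc a b := ⟨hz.1, by linarith [hz.2]⟩
      have h1 := hqe z
      have h2 := hbd z hz'
      rw [hpb] at h1
      have h3 : (b - z) * |q.eval z| ≤ ρ := by
        rw [← abs_of_pos (show 0 < b - z by linarith [hz.2]), ← abs_mul, abs_le]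
        constructor <;> nlinarith
      rw [le_div_iff₀ (by linarith)]
      nlinarith [hz.2, abs_nonneg (q.eval z)])
  have hba : 0 < b - a := by linarith
  have hη1 : 1 / (4 * C) ≤ 1 := by rw [div_le_one (by positivity)]; linarith
  have hya : y ∈ Set.Icc a b := ⟨by nlinarith [hy.1], hy.2⟩
  have h1 := hm y hya
  have h2 := hqe y
  rw [hpb] at h2
  have h4 : b - y ≤ 1 / (4 * C) * (b - a) := by linarith [hy.1]
  have h3 : (b - y) * q.eval y ≤ ρ / 2 := by
    calc (b - y) * q.eval y ≤ (b - y) * (C * (2 * ρ / (b - a))) :=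
          mul_le_mul_of_nonneg_left ((le_abs_self _).trans h1) (by linarith [hy.2])
      _ ≤ (1 / (4 * C) * (b - a)) * (C * (2 * ρ / (b - a))) := by gcongr
      _ = ρ / 2 := by field_simp; ring
  linarith

lemma remez' (N : ℕ) (η : ℝ) (hη : 0 < η) : ∃ C : ℝ, 1 ≤ C ∧ ∀ p : Polynomial ℝ, p.natDegree ≤ N →
    ∀ a b c d ρ : ℝ, a ≤ c → d ≤ b → c < d → η * (b - a) ≤ d - c → 0 < ρ →
    (∀ y ∈ Set.Icc a b, 0 ≤ p.eval y) → 
    (∃ z ∈ Set.Icc a b, ρ ≤ p.eval z) → ∃ z ∈ Set.Icc c d, ρ / (2 * C) ≤ p.eval z := by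
  obtain ⟨C, hC, hr⟩ := remez N η hη
  refine ⟨C, hC, ?_⟩
  intro p hp a b c d ρ hac hdb hcd h1 hρ hnn ⟨z, hz, hz2⟩
  by_contra! hcon
  have := hr p hp a b c d (ρ / (2 * C)) hac hdb hcd h1 (by
    intro y hy
    rw [abs_of_nonneg (hnn y ⟨hac.trans hy.1, hy.2.trans hdb⟩)]
    exact (hcon y hy).le) z hz
  have h2 : C * (ρ / (2 * C)) = ρ / 2 := by field_simp
  rw [h2] at this
  linarith [le_abs_self (p.eval z)]

lemma km {X : Type*} (K : Finset ℕ) (rel : ℕ → X → X → Prop)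
    (hrefl : ∀ k x, rel k x x) (htrans : ∀ k x y z, rel k x y → rel k y z → rel k x z)
    (f : ℕ → X → Polynomial ℝ) (N : ℕ) (hdeg : ∀ k x, (f k x).natDegree ≤ N)
    (hnn : ∀ k x (z : ℝ), 0 ≤ z → 0 ≤ (f k x).eval z)
    (hinv : ∀ k x y, rel k x y → ∀ z : ℝ, 0 ≤ z → (f k x).eval z = (f k y).eval z) :
    ∀ m : ℕ, ∃ c : ℝ, 0 < c ∧ c ≤ 1 ∧ ∀ I : Finset ℕ, (K \ I).card = m →
    ∀ (x0 : X) (a b ρ : ℝ), 0 ≤ a → a < b → 0 < ρ →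
    (∀ k ∈ K \ I, ∀ x, (∀ i ∈ I, rel i x0 x) → ∃ z ∈ Set.Icc a b, ρ ≤ (f k x).eval z) →
    ∃ z ∈ Set.Icc a b, ∃ J : Finset ℕ, I ⊆ J ∧ ∃ x1 : X, (∀ i ∈ I, rel i x0 x1) ∧
      (∀ k ∈ J \ I, (f k x1).eval z ≤ ρ) ∧
      (∀ k ∈ K \ I, ∀ x, (∀ j ∈ J, rel j x1 x) → c * ρ ≤ (f k x).eval z) := by
  obtain ⟨η, hη0, hη1, hnear⟩ := poly_near N
  obtain ⟨C, hC, hrem⟩ := remez' N (η / 2) (by positivity)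
  intro m
  induction m with
  | zero =>
    refine ⟨1, one_pos, le_rfl, ?_⟩
    intro I hI x0 a b ρ ha hab hρ _
    rw [Finset.card_eq_zero] at hI
    refine ⟨a, ⟨le_rfl, hab.le⟩, I, subset_rfl, x0, fun i _ => hrefl i x0, ?_, ?_⟩
    · intro k hk; simp at hk
    · intro k hk; rw [hI] at hk; simp at hk
  | succ m ih =>
    obtain ⟨c, hc0, hc1, ih⟩ := ih
    refine ⟨c / (2 * C), by positivity, ?_, ?_⟩
    · rw [div_le_one (by positivity)]; linarith
    intro I hI x0 a b ρ ha hab hρ hsup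
    have hc2 : c / (2 * C) ≤ 1 / 2 := by
      rw [div_le_div_iff₀ (by positivity) (by norm_num)]; nlinarith
    by_cases hall : ∀ k ∈ K \ I, ∀ x, (∀ i ∈ I, rel i x0 x) → ρ ≤ (f k x).eval a
    · refine ⟨a, ⟨le_rfl, hab.le⟩, I, subset_rfl, x0, fun i _ => hrefl i x0, ?_, ?_⟩
      · intro k hk; simp at hk
      · intro k hk x hx
        have := hall k hk x hx
        nlinarith
    push Not at hall
    obtain ⟨k0, hk0, y0, hy0, hlt⟩ := hall
    let T := {s : ℕ × X // s.1 ∈ K \ I ∧ ∀ i ∈ I, rel i x0 s.2}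
    let Z : T → Set ℝ := fun s => {z | z ∈ Set.Icc a b ∧ ρ ≤ (f s.1.1 s.1.2).eval z}
    have hZc : ∀ s, IsCompact (Z s) := fun s =>
      isCompact_Icc.inter_right (isClosed_le continuous_const (Polynomial.continuous _))
    have hZn : ∀ s, (Z s).Nonempty := by
      intro s
      obtain ⟨z, hz, hz2⟩ := hsup s.1.1 s.2.1 s.1.2 s.2.2
      exact ⟨z, hz, hz2⟩
    let bs : T → ℝ := fun s => sInf (Z s)
    have hbs : ∀ s, bs s ∈ Z s := fun s => (hZc s).sInf_mem (hZn s)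
    have hbs2 : ∀ s, ∀ z ∈ Z s, bs s ≤ z := fun s z hz => csInf_le (hZc s).bddBelow hz
    have hbdd : BddAbove (Set.range bs) := ⟨b, by rintro _ ⟨s, rfl⟩; exact (hbs s).1.2⟩
    let s0 : T := ⟨(k0, y0), hk0, hy0⟩
    have : Nonempty T := ⟨s0⟩
    set B := iSup bs with hB
    have hBle : ∀ s, bs s ≤ B := fun s => le_ciSup hbdd s
    have hBb : B ≤ b := ciSup_le fun s => (hbs s).1.2
    have hs0 : a < bs s0 := by
      rcases (hbs s0).1.1.lt_or_eq with h | h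
      · exact h
      · exfalso
        have := (hbs s0).2
        rw [← h] at this
        exact absurd this (not_le.2 hlt)
    have haB : a < B := hs0.trans_le (hBle s0)
    obtain ⟨s, hs⟩ := exists_lt_of_lt_ciSup (show (a + B) / 2 < iSup bs by rw [← hB]; linarith)
    obtain ⟨⟨k, x⟩, hk, hx⟩ := s
    set e := bs ⟨(k, x), hk, hx⟩ with he
    have heZ := hbs ⟨(k, x), hk, hx⟩
    rw [← he] at heZ
    have hemin : ∀ z, z ∈ Set.Icc a b → ρ ≤ (f k x).eval z → e ≤ z :=
      fun z h1 h2 => hbs2 ⟨(k, x), hk, hx⟩ z ⟨h1, h2⟩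
    have hae : a < e := by linarith
    have heb : e ≤ b := heZ.1.2
    have heB : e ≤ B := hBle _
    have hlt : ∀ z, a ≤ z → z < e → (f k x).eval z < ρ := by
      intro z h1 h2
      by_contra h
      exact absurd (hemin z ⟨h1, by linarith⟩ (not_lt.1 h)) (not_le.2 h2)
    have heq : (f k x).eval e = ρ := by
      obtain ⟨y, hy, hy2⟩ := intermediate_value_Icc hae.le
        ((f k x).continuous.continuousOn (s := Set.Icc a e))
        (show ρ ∈ Set.Icc ((f k x).eval a) ((f k x).eval e) from ⟨(hlt a le_rfl hae).le, heZ.2⟩)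
      have : e ≤ y := hemin y ⟨hy.1, hy.2.trans heb⟩ hy2.ge
      rw [le_antisymm this hy.2]; exact hy2
    have hle : ∀ z ∈ Set.Icc a e, 0 ≤ (f k x).eval z ∧ (f k x).eval z ≤ ρ := by
      intro z hz
      refine ⟨hnn _ _ _ (ha.trans hz.1), ?_⟩
      rcases hz.2.lt_or_eq with h | h
      · exact (hlt z hz.1 h).le
      · rw [h, heq]
    have hn := hnear (f k x) (hdeg k x) a e ρ hae hρ hle heq
    set a' := e - η * (e - a) with ha'
    have haa' : a ≤ a' := by nlinarith
    have ha'e : a' < e := by nlinarith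
    obtain ⟨z, hz, J, hJ, x1, hx1, hsm, hlg⟩ := ih (insert k I) (by
        rw [Finset.sdiff_insert, Finset.card_erase_of_mem hk, hI]; rfl) x a' e (ρ / (2 * C))
        (ha.trans haa') ha'e (by positivity) (by
          intro k' hk' x' hx'
          have hk'' : k' ∈ K \ I := by
            simp only [Finset.mem_sdiff, Finset.mem_insert, not_or] at hk' ⊢
            exact ⟨hk'.1, hk'.2.2⟩
          have hx'' : ∀ i ∈ I, rel i x0 x' := fun i hi =>
            htrans i _ _ _ (hx i hi) (hx' i (Finset.mem_insert_of_mem hi))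
          refine hrem (f k' x') (hdeg _ _) a B a' e ρ haa' heB ha'e ?_ hρ
            (fun y hy => hnn _ _ _ (ha.trans hy.1)) ?_
          · rw [ha']; nlinarith
          · have h1 := hbs ⟨(k', x'), hk'', hx''⟩
            exact ⟨_, ⟨h1.1.1, hBle _⟩, h1.2⟩)
    have hz0 : 0 ≤ z := ha.trans (haa'.trans hz.1)
    have hρ' : ρ / (2 * C) ≤ ρ := by
      rw [div_le_iff₀ (by positivity)]; nlinarith
    have hkx1 := hx1 k (Finset.mem_insert_self _ _)
    refine ⟨z, ⟨haa'.trans hz.1, hz.2.trans heb⟩, J, (Finset.subset_insert _ _).trans hJ, x1,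
      fun i hi => htrans i _ _ _ (hx i hi) (hx1 i (Finset.mem_insert_of_mem hi)), ?_, ?_⟩
    · intro k' hk'
      by_cases h : k' = k
      · subst h
        rw [← hinv _ _ _ hkx1 z hz0]
        exact (hle z ⟨haa'.trans hz.1, hz.2⟩).2
      · refine (hsm k' ?_).trans hρ'
        simp only [Finset.mem_sdiff, Finset.mem_insert, not_or] at hk' ⊢
        exact ⟨hk'.1, h, hk'.2⟩
    · intro k' hk' x' hx'
      by_cases h : k' = k
      · subst h
        rw [← hinv _ _ _ (htrans _ _ _ _ hkx1 (hx' k' (hJ (Finset.mem_insert_self _ _)))) z hz0]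
        have := hn z hz
        nlinarith
      · have := hlg k' (by
          simp only [Finset.mem_sdiff, Finset.mem_insert, not_or] at hk' ⊢
          exact ⟨hk'.1, h, hk'.2⟩) x' hx'
        calc c / (2 * C) * ρ = c * (ρ / (2 * C)) := by ring
          _ ≤ _ := this

/-- leading principal minor of the Gram matrix -/
def lgm {R : Type*} [CommRing R] {n : ℕ} (k : ℕ) (A : Matrix (Fin n) (Fin n) R) : R :=
  ((Aᵀ * A).submatrix (Subtype.val : {i : Fin n // (i : ℕ) < k} → Fin n) Subtype.val).det

/-- columns -/
noncomputable def cv {n : ℕ} (A : Matrix (Fin n) (Fin n) ℝ) (j : Fin n) :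
    EuclideanSpace ℝ (Fin n) := WithLp.toLp 2 (fun i => A i j)

lemma inner_cv {n : ℕ} (A : Matrix (Fin n) (Fin n) ℝ) (i j : Fin n) :
    inner ℝ (cv A i) (cv A j) = (Aᵀ * A) i j := by
  simp [cv, PiLp.inner_apply, Matrix.mul_apply, mul_comm]

open InnerProductSpace in
lemma lgm_eq {n : ℕ} (k : ℕ) (A : Matrix (Fin n) (Fin n) ℝ) :
    lgm k A = ∏ i : {i : Fin n // (i : ℕ) < k}, ‖gramSchmidt ℝ (cv A) i‖ ^ 2 := by
  set g := gramSchmidt ℝ (cv A) with hg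
  let L : Matrix (Fin n) (Fin n) ℝ := fun m j =>
    if m < j then inner ℝ (g m) (cv A j) / ‖g m‖ ^ 2 else if m = j then 1 else 0
  have hL0 : ∀ m j, j < m → L m j = 0 := by
    intro m j h
    simp [L, not_lt.2 h.le, h.ne']
  have hL1 : ∀ m, L m m = 1 := by intro m; simp [L]
  have hb : ∀ j, cv A j = ∑ m, L m j • g m := by
    intro j
    have h1 := gramSchmidt_def'' ℝ (cv A) j
    have h2 : ∑ m, L m j • g m = ∑ m ∈ Finset.Iic j, L m j • g m := by
      symm
      apply Finset.sum_subset (Finset.subset_univ _)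
      intro m _ hm
      rw [hL0 m j (by simpa using hm), zero_smul]
    rw [h2, ← Finset.Iio_insert, Finset.sum_insert (by simp), hL1, one_smul]
    conv_lhs => rw [h1]
    congr 1
    apply Finset.sum_congr rfl
    intro m hm
    have : m < j := by simpa using hm
    simp [L, this, hg]
  have hin : ∀ i j, (Aᵀ * A) i j = ∑ m, L m i * ‖g m‖ ^ 2 * L m j := by
    intro i j
    rw [← inner_cv, hb i, hb j, sum_inner]
    apply Finset.sum_congr rfl
    intro m _
    rw [inner_sum, Finset.sum_eq_single m]
    · rw [inner_smul_left, inner_smul_right, real_inner_self_eq_norm_sq]; simp; ring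
    · intro l _ hl
      rw [inner_smul_left, inner_smul_right, gramSchmidt_orthogonal ℝ (cv A) hl.symm]; simp
    · simp
  let Ls : Matrix {i : Fin n // (i : ℕ) < k} {i : Fin n // (i : ℕ) < k} ℝ := L.submatrix (Subtype.val : {i : Fin n // (i : ℕ) < k} → Fin n) Subtype.val
  have hs : (Aᵀ * A).submatrix (Subtype.val : {i : Fin n // (i : ℕ) < k} → Fin n) Subtype.val
      = Lsᵀ * Matrix.diagonal (fun i : {i : Fin n // (i : ℕ) < k} => ‖g i‖ ^ 2) * Ls := by
    ext i j
    rw [Matrix.submatrix_apply, hin, Matrix.mul_apply]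
    symm
    apply Fintype.sum_of_injective Subtype.val Subtype.val_injective
    · intro m hm
      have hm' : k ≤ (m : ℕ) := by
        by_contra h
        exact hm ⟨⟨m, not_le.1 h⟩, rfl⟩
      have : (j : Fin n) < m := by
        have := j.2
        rw [Fin.lt_def]; omega
      rw [hL0 m j this, mul_zero]
    · intro m
      simp [Ls, Matrix.mul_diagonal]
  have hdet : Ls.det = 1 := by
    rw [Matrix.det_of_isUpperTriangular]
    · simp [Ls, hL1]
    · intro i j hij
      exact hL0 _ _ hij
  rw [lgm, hs, Matrix.det_mul, Matrix.det_mul, Matrix.det_transpose, hdet, Matrix.det_diagonal]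
  simp

open InnerProductSpace in
lemma gs_sub_mem {n : ℕ} (b : Fin n → EuclideanSpace ℝ (Fin n)) (j : Fin n) :
    b j - gramSchmidt ℝ b j ∈ Submodule.span ℝ (b '' Set.Iio j) := by
  rw [← span_gramSchmidt_Iio]
  have h := gramSchmidt_def'' ℝ b j
  rw [← sub_eq_iff_eq_add'] at h
  rw [h]
  apply Submodule.sum_mem
  intro i hi
  apply Submodule.smul_mem
  apply Submodule.subset_span
  exact ⟨i, by simpa using hi, rfl⟩

open InnerProductSpace in
lemma gs_norm_le {n : ℕ} (b : Fin n → EuclideanSpace ℝ (Fin n)) (j : Fin n)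
    (w : EuclideanSpace ℝ (Fin n)) (hw : w ∈ Submodule.span ℝ (b '' Set.Iio j)) :
    ‖gramSchmidt ℝ b j‖ ≤ ‖b j - w‖ := by
  have h1 : b j - gramSchmidt ℝ b j - w ∈ Submodule.span ℝ (gramSchmidt ℝ b '' Set.Iio j) := by
    rw [span_gramSchmidt_Iio]
    exact Submodule.sub_mem _ (gs_sub_mem b j) hw
  have h2 : inner ℝ (gramSchmidt ℝ b j) (b j - gramSchmidt ℝ b j - w) = 0 := by
    generalize b j - gramSchmidt ℝ b j - w = v at h1
    induction h1 using Submodule.span_induction with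
    | mem x hx =>
      obtain ⟨i, hi, rfl⟩ := hx
      exact gramSchmidt_orthogonal ℝ b (ne_of_gt hi)
    | zero => simp
    | add x y _ _ hx hy => rw [inner_add_right, hx, hy, add_zero]
    | smul c x _ hx => rw [inner_smul_right, hx, mul_zero]
  have h3 : b j - w = gramSchmidt ℝ b j + (b j - gramSchmidt ℝ b j - w) := by abel
  have h4 := norm_add_sq_eq_norm_sq_add_norm_sq_of_inner_eq_zero _ _ h2
  rw [← h3] at h4
  nlinarith [norm_nonneg (gramSchmidt ℝ b j), norm_nonneg (b j - w),
    norm_nonneg (b j - gramSchmidt ℝ b j - w)]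

lemma cv_li {n : ℕ} (A : Matrix (Fin n) (Fin n) ℝ) (h : A.det ≠ 0) :
    LinearIndependent ℝ (cv A) := by
  have := Matrix.linearIndependent_cols_of_det_ne_zero h
  have h2 := this.map' (WithLp.linearEquiv 2 ℝ (Fin n → ℝ)).symm.toLinearMap (LinearEquiv.ker _)
  exact h2

open InnerProductSpace in
lemma gs_pos {n : ℕ} (A : Matrix (Fin n) (Fin n) ℝ) (h : A.det ≠ 0) (j : Fin n) :
    0 < ‖gramSchmidt ℝ (cv A) j‖ := norm_pos_iff.2 (gramSchmidt_ne_zero j (cv_li A h))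

lemma lgm_pos {n : ℕ} (k : ℕ) (A : Matrix (Fin n) (Fin n) ℝ) (h : A.det ≠ 0) : 0 < lgm k A := by
  rw [lgm_eq]
  exact Finset.prod_pos fun i _ => pow_pos (gs_pos A h _) 2

lemma lgm_nonneg {n : ℕ} (k : ℕ) (A : Matrix (Fin n) (Fin n) ℝ) : 0 ≤ lgm k A := by
  rw [lgm_eq]
  exact Finset.prod_nonneg fun i _ => by positivity

lemma lgm_zero {n : ℕ} (A : Matrix (Fin n) (Fin n) ℝ) : lgm 0 A = 1 := by
  rw [lgm]
  have : IsEmpty {i : Fin n // (i : ℕ) < 0} := ⟨fun i => by have := i.2; omega⟩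
  exact Matrix.det_isEmpty

open InnerProductSpace in
lemma lgm_succ {n : ℕ} (A : Matrix (Fin n) (Fin n) ℝ) (j : Fin n) :
    lgm (j + 1) A = lgm j A * ‖gramSchmidt ℝ (cv A) j‖ ^ 2 := by
  have key : ∀ k : ℕ, lgm k A = ∏ i with (i : Fin n).val < k, ‖gramSchmidt ℝ (cv A) i‖ ^ 2 := by
    intro k
    rw [lgm_eq, Finset.prod_subtype (p := fun i : Fin n => (i : ℕ) < k)]
    simp
  rw [key, key]
  have : (Finset.univ.filter fun i : Fin n => (i : ℕ) < j + 1) =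
      insert j (Finset.univ.filter fun i : Fin n => (i : ℕ) < j) := by
    ext i
    simp only [Finset.mem_filter, Finset.mem_univ, true_and, Finset.mem_insert, Fin.ext_iff]
    omega
  rw [this, Finset.prod_insert (by simp), mul_comm]

lemma lgm_top {n : ℕ} (A : Matrix (Fin n) (Fin n) ℝ) (h : A.det = 1) : lgm n A = 1 := by
  rw [lgm]
  let e : {i : Fin n // (i : ℕ) < n} ≃ Fin n := Equiv.subtypeUnivEquiv (fun i => i.2)
  have : (Aᵀ * A).submatrix (Subtype.val : {i : Fin n // (i : ℕ) < n} → Fin n) Subtype.val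
      = (Aᵀ * A).submatrix e e := rfl
  rw [this, Matrix.det_submatrix_equiv_self, Matrix.det_mul, Matrix.det_transpose, h, one_mul]

/-- integer span of the first columns -/
def Lsp {n : ℕ} (k : ℕ) (γ : Matrix (Fin n) (Fin n) ℤ) : Submodule ℤ (Fin n → ℤ) :=
  Submodule.span ℤ (Set.range fun j : {i : Fin n // (i : ℕ) < k} => fun a => γ a j)

/-- the matrix `h γ` -/
def HG {n : ℕ} (h : SL(n, ℝ)) (γ : SL(n, ℤ)) : Matrix (Fin n) (Fin n) ℝ :=
  h.1 * γ.1.map (Int.castRingHom ℝ)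

lemma det_cast {n : ℕ} (γ : SL(n, ℤ)) : (γ.1.map (Int.castRingHom ℝ)).det = 1 := by
  have := (Int.castRingHom ℝ).map_det γ.1
  rw [γ.2, map_one] at this
  exact this.symm

lemma HG_det {n : ℕ} (h : SL(n, ℝ)) (γ : SL(n, ℤ)) : (HG h γ).det = 1 := by
  rw [HG, Matrix.det_mul, h.2, one_mul, det_cast]

lemma lgm_le {n : ℕ} (k : ℕ) (h : SL(n, ℝ)) (γ γ' : SL(n, ℤ)) (hL : Lsp k γ'.1 ≤ Lsp k γ.1) :
    lgm k (HG h γ) ≤ lgm k (HG h γ') := by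
  have h1 : ∀ j : {i : Fin n // (i : ℕ) < k}, ∃ c : {i : Fin n // (i : ℕ) < k} → ℤ,
      ∑ i, c i • (fun a => γ.1 a i) = fun a => γ'.1 a j := by
    intro j
    have : (fun a => γ'.1 a j) ∈ Lsp k γ.1 := hL (Submodule.subset_span ⟨j, rfl⟩)
    exact (Submodule.mem_span_range_iff_exists_fun ℤ).1 this
  choose c hc using h1
  let B : Matrix {i : Fin n // (i : ℕ) < k} {i : Fin n // (i : ℕ) < k} ℤ := fun i j => c j i
  let N := fun γ : SL(n, ℤ) => (HG h γ).submatrix id (Subtype.val : {i : Fin n // (i : ℕ) < k} → Fin n)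
  have hN : ∀ γ, lgm k (HG h γ) = ((N γ)ᵀ * N γ).det := fun γ => rfl
  have hNB : N γ' = N γ * B.map (Int.castRingHom ℝ) := by
    ext a j
    simp only [N, HG, Matrix.mul_apply, Matrix.submatrix_apply, id, Matrix.map_apply, Finset.sum_mul]
    rw [Finset.sum_comm]
    apply Finset.sum_congr rfl
    intro l _
    have := congrFun (hc j) l
    rw [← this]
    simp only [Finset.sum_apply, Pi.smul_apply, smul_eq_mul, map_sum, map_mul, Finset.mul_sum, B]
    apply Finset.sum_congr rfl
    intro i _
    ring
  have hB : (B.map (Int.castRingHom ℝ)).det = (B.det : ℝ) := ((Int.castRingHom ℝ).map_det B).symm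
  have key : lgm k (HG h γ') = (B.det : ℝ) ^ 2 * lgm k (HG h γ) := by
    rw [hN, hN, hNB, Matrix.transpose_mul, Matrix.mul_assoc, ← Matrix.mul_assoc (N γ)ᵀ,
      Matrix.det_mul, Matrix.det_mul, Matrix.det_transpose, hB]
    ring
  have p1 := lgm_pos k (HG h γ) (by rw [HG_det]; exact one_ne_zero)
  have p2 := lgm_pos k (HG h γ') (by rw [HG_det]; exact one_ne_zero)
  have hd : B.det ≠ 0 := by
    intro h0
    rw [key, h0] at p2
    simp at p2
  have hd2 : (1 : ℝ) ≤ (B.det : ℝ) ^ 2 := by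
    have : (1 : ℤ) ≤ B.det ^ 2 := by
      have := sq_pos_of_ne_zero hd
      omega
    exact_mod_cast this
  rw [key]
  nlinarith

lemma lgm_congr {n : ℕ} (k : ℕ) (h : SL(n, ℝ)) (γ γ' : SL(n, ℤ)) (hL : Lsp k γ.1 = Lsp k γ'.1) :
    lgm k (HG h γ) = lgm k (HG h γ') :=
  le_antisymm (lgm_le k h γ γ' hL.ge) (lgm_le k h γ' γ hL.le)

lemma Lsp_tr_le {n : ℕ} (k : ℕ) (γ : Matrix (Fin n) (Fin n) ℤ) (i j : Fin n) (c : ℤ)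
    (hk : (j : ℕ) < k → (i : ℕ) < k) : Lsp k (γ * Matrix.transvection i j c) ≤ Lsp k γ := by
  rw [Lsp, Submodule.span_le]
  rintro _ ⟨l, rfl⟩
  by_cases hl : l.1 = j
  · have : (fun a => (γ * Matrix.transvection i j c) a l) =
        (fun a => γ a l) + c • (fun a => γ a i) := by
      ext a
      rw [hl]
      simp [Matrix.mul_transvection_apply_same]
    simp only [this]
    refine Submodule.add_mem _ (Submodule.subset_span ⟨l, rfl⟩)
      (Submodule.smul_mem _ _ (Submodule.subset_span ⟨⟨i, hk (hl ▸ l.2)⟩, rfl⟩))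
  · have : (fun a => (γ * Matrix.transvection i j c) a l) = (fun a => γ a l) := by
      ext a
      rw [Matrix.mul_transvection_apply_of_ne _ _ _ _ hl]
    simp only [this]
    exact Submodule.subset_span ⟨l, rfl⟩

lemma Lsp_tr {n : ℕ} (k : ℕ) (γ : Matrix (Fin n) (Fin n) ℤ) (i j : Fin n) (hij : i ≠ j) (c : ℤ)
    (hk : (j : ℕ) < k → (i : ℕ) < k) : Lsp k (γ * Matrix.transvection i j c) = Lsp k γ := by
  refine le_antisymm (Lsp_tr_le k γ i j c hk) ?_
  have := Lsp_tr_le k (γ * Matrix.transvection i j c) i j (-c) hk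
  rwa [Matrix.mul_assoc, Matrix.transvection_mul_transvection_same i j hij, add_neg_cancel,
    Matrix.transvection_zero, Matrix.mul_one] at this

lemma lgm_col {n : ℕ} (k : ℕ) (A A' : Matrix (Fin n) (Fin n) ℝ)
    (h : ∀ a j : Fin n, (j : ℕ) < k → A a j = A' a j) : lgm k A = lgm k A' := by
  rw [lgm, lgm]
  congr 1
  ext i j
  simp only [Matrix.submatrix_apply, Matrix.mul_apply, Matrix.transpose_apply]
  apply Finset.sum_congr rfl
  intro a _
  rw [h a i i.2, h a j j.2]

open InnerProductSpace in
lemma swap_step {n : ℕ} (A : Matrix (Fin n) (Fin n) ℝ) (p q : Fin n) (hpq : (q : ℕ) = p + 1) :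
    ∃ m : ℤ, ∀ A' : Matrix (Fin n) (Fin n) ℝ,
      (∀ j, j < p → cv A' j = cv A j) → cv A' p = cv A q + (1 - m : ℝ) • cv A p →
      lgm q A' ≤ lgm p A * (‖gramSchmidt ℝ (cv A) q‖ ^ 2 + ‖gramSchmidt ℝ (cv A) p‖ ^ 2 / 4) := by
  have hlt : p < q := by rw [Fin.lt_def]; omega
  have h1 := gs_sub_mem (cv A) q
  have h2 := gs_sub_mem (cv A) p
  have hI : Set.Iio q = insert p (Set.Iio p) := by
    ext x
    simp only [Set.mem_Iio, Set.mem_insert_iff, Fin.lt_def, Fin.ext_iff]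
    omega
  rw [hI, Set.image_insert_eq, Submodule.mem_span_insert] at h1
  obtain ⟨α, w1, hw1, hα⟩ := h1
  refine ⟨round (α + 1), ?_⟩
  intro A' hA1 hA2
  set s : ℝ := α + 1 - round (α + 1) with hs
  have hs2 : |s| ≤ 1 / 2 := abs_sub_round (α + 1)
  set g := gramSchmidt ℝ (cv A) with hg
  have himg : cv A' '' Set.Iio p = cv A '' Set.Iio p := Set.image_congr fun j hj => hA1 j hj
  have hle := gs_norm_le (cv A') p (w1 + s • (cv A p - g p)) (by
    rw [himg]
    exact Submodule.add_mem _ hw1 (Submodule.smul_mem _ _ h2))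
  have heq : cv A' p - (w1 + s • (cv A p - g p)) = g q + s • g p := by
    rw [hA2]
    have : cv A q = g q + (α • cv A p + w1) := by rw [← hα]; abel
    rw [this, hs]
    module
  rw [heq] at hle
  have horth : inner ℝ (g q) (s • g p) = 0 := by
    rw [inner_smul_right, gramSchmidt_orthogonal ℝ (cv A) hlt.ne', mul_zero]
  have hn := norm_add_sq_eq_norm_sq_add_norm_sq_of_inner_eq_zero _ _ horth
  have hsq : ‖gramSchmidt ℝ (cv A') p‖ ^ 2 ≤ ‖g q‖ ^ 2 + ‖g p‖ ^ 2 / 4 := by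
    have h3 : ‖gramSchmidt ℝ (cv A') p‖ ^ 2 ≤ ‖g q + s • g p‖ ^ 2 := by gcongr
    have h4 : ‖s • g p‖ ^ 2 ≤ ‖g p‖ ^ 2 / 4 := by
      rw [norm_smul, mul_pow, Real.norm_eq_abs]
      have : |s| ^ 2 ≤ (1 / 2) ^ 2 := by gcongr
      nlinarith [sq_nonneg ‖g p‖]
    nlinarith
  have hlg : lgm p A' = lgm p A := by
    apply lgm_col
    intro a j hj
    have := congrArg (fun v : EuclideanSpace ℝ (Fin n) => v a) (hA1 j hj)
    simpa [cv] using this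
  rw [hpq, lgm_succ, hlg]
  exact mul_le_mul_of_nonneg_left hsq (lgm_nonneg _ _)

open InnerProductSpace in
lemma size_red {n : ℕ} (b : Fin n → EuclideanSpace ℝ (Fin n)) (r : ℝ) 
    (hr : ∀ i, ‖gramSchmidt ℝ b i‖ ≤ r) : ∀ k : ℕ, k ≤ n → 
    ∀ w ∈ Submodule.span ℝ (b '' {i | (i : ℕ) < k}),
    ∃ c : Fin n → ℤ, (∀ i : Fin n, k ≤ i → c i = 0) ∧ ‖w - ∑ i, (c i : ℝ) • b i‖ ≤ k * r := by
  intro k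
  induction k with
  | zero =>
    intro _ w hw
    refine ⟨0, by simp, ?_⟩
    have : w = 0 := by simpa using hw
    simp [this]
  | succ k ih =>
    intro hk w hw
    let p : Fin n := ⟨k, hk⟩
    have hI : {i : Fin n | (i : ℕ) < k + 1} = insert p {i : Fin n | (i : ℕ) < k} := by
      ext x
      simp only [Set.mem_ofPred_eq, Set.mem_insert_iff, Fin.ext_iff, p]
      omega
    rw [hI, Set.image_insert_eq, Submodule.mem_span_insert] at hw
    obtain ⟨α, w0, hw0, rfl⟩ := hw
    set s : ℝ := α - round α with hs
    have hs2 : |s| ≤ 1 / 2 := abs_sub_round α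
    have h2 := gs_sub_mem b p
    obtain ⟨c, hc, hcn⟩ := ih (by omega) (w0 + s • (b p - gramSchmidt ℝ b p))
      (Submodule.add_mem _ hw0 (Submodule.smul_mem _ _ h2))
    refine ⟨c + Pi.single p (round α), ?_, ?_⟩
    · intro i hi
      have : i ≠ p := by
        rintro rfl
        simp only [p] at hi; omega
      simp [hc i (by omega), this]
    · have hsum : ∑ i, (((c + Pi.single p (round α) : Fin n → ℤ) i : ℤ) : ℝ) • b i =
          ∑ i, (c i : ℝ) • b i + (round α : ℝ) • b p := by
        simp only [Pi.add_apply, Int.cast_add, add_smul, Finset.sum_add_distrib]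
        congr 1
        rw [Finset.sum_eq_single p]
        · simp
        · intro i _ hi; simp [hi]
        · simp
      have h3 : α • b p + w0 - ∑ i, (((c + Pi.single p (round α) : Fin n → ℤ) i : ℤ) : ℝ) • b i =
          (w0 + s • (b p - gramSchmidt ℝ b p) - ∑ i, (c i : ℝ) • b i) + s • gramSchmidt ℝ b p := by
        rw [hsum, hs]; module
      rw [h3]
      have h4 : ‖s • gramSchmidt ℝ b p‖ ≤ r := by
        rw [norm_smul, Real.norm_eq_abs]
        nlinarith [hr p, norm_nonneg (gramSchmidt ℝ b p), abs_nonneg s]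
      calc _ ≤ _ := norm_add_le _ _
        _ ≤ k * r + r := add_le_add hcn h4
        _ = _ := by push_cast; ring

open InnerProductSpace in
lemma reduce (n : ℕ) (ε : ℝ) (hε : 0 < ε) (hε1 : ε ≤ 1) : ∃ R : ℝ, ∀ (h : SL(n, ℝ)) (γ0 : SL(n, ℤ))
    (J : Finset ℕ), (∀ k ∈ J, lgm k (HG h γ0) ≤ 1) →
    (∀ k ∈ Finset.Ioo 0 n, ∀ γ : SL(n, ℤ), (∀ j ∈ J, Lsp j γ0.1 = Lsp j γ.1) →
      ε ≤ lgm k (HG h γ)) → ∃ γ : SL(n, ℤ), ∀ i j, |HG h γ i j| ≤ R := by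
  set r : ℝ := Real.sqrt (4 ^ (n ^ 2) / ε) with hr
  refine ⟨n * r + r, ?_⟩
  intro h γ0 J hJ hlow
  let P : SL(n, ℤ) → ℝ := fun γ => ∏ k ∈ Finset.Ioo 0 n, lgm k (HG h γ)
  let S : Set SL(n, ℤ) := {γ | ∀ j ∈ J, Lsp j γ0.1 = Lsp j γ.1}
  have hpos : ∀ k γ, 0 < lgm k (HG h γ) := fun k γ =>
    lgm_pos k (HG h γ) (by rw [HG_det]; exact one_ne_zero)
  have hPlow : ∀ γ ∈ S, ε ^ (Finset.Ioo 0 n).card ≤ P γ := by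
    intro γ hγ
    rw [← Finset.prod_const]
    exact Finset.prod_le_prod (fun _ _ => hε.le) fun k hk => hlow k hk γ hγ
  obtain ⟨γ, hγS, hγmin⟩ : ∃ γ ∈ S, ∀ γ' ∈ S, P γ ≤ 3 / 2 * P γ' := by
    have hne : (P '' S).Nonempty := ⟨P γ0, γ0, fun _ _ => rfl, rfl⟩
    have hbd : BddBelow (P '' S) := ⟨ε ^ (Finset.Ioo 0 n).card, by
      rintro _ ⟨γ, hγ, rfl⟩; exact hPlow γ hγ⟩
    have hm : 0 < sInf (P '' S) := lt_of_lt_of_le (pow_pos hε (Finset.Ioo 0 n).card)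
      (le_csInf hne (by rintro _ ⟨γ, hγ, rfl⟩; exact hPlow γ hγ))
    obtain ⟨_, ⟨γ, hγ, rfl⟩, h2⟩ := exists_lt_of_csInf_lt hne
      (show sInf (P '' S) < 3 / 2 * sInf (P '' S) by linarith)
    refine ⟨γ, hγ, fun γ' hγ' => h2.le.trans ?_⟩
    have := csInf_le hbd ⟨γ', hγ', rfl⟩
    linarith
  set D : ℕ → ℝ := fun k => lgm k (HG h γ) with hD
  set g := gramSchmidt ℝ (cv (HG h γ)) with hg
  have hDs : ∀ j : Fin n, D (j + 1) = D j * ‖g j‖ ^ 2 := fun j => lgm_succ _ j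
  have hDpos : ∀ k, 0 < D k := fun k => hpos k γ
  have hconv : ∀ p : ℕ, p + 1 < n → p + 1 ∉ J → D (p + 1) ^ 2 ≤ 4 * D p * D (p + 2) := by
    intro p' hp hpJ
    let p : Fin n := ⟨p', by omega⟩
    let q : Fin n := ⟨p' + 1, hp⟩
    have hpq : p ≠ q := by simp [p, q]
    obtain ⟨m, hm⟩ := swap_step (HG h γ) p q rfl
    let γ' : SL(n, ℤ) := ⟨γ.1 * Matrix.transvection p q (-m) * Matrix.transvection q p 1, by
      rw [Matrix.det_mul, Matrix.det_mul, γ.2, Matrix.det_transvection_of_ne _ _ hpq,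
        Matrix.det_transvection_of_ne _ _ hpq.symm]; rfl⟩
    have hLs : ∀ j, j ≠ p' + 1 → Lsp j γ.1 = Lsp j γ'.1 := by
      intro j hj
      symm
      change Lsp j (γ.1 * Matrix.transvection p q (-m) * Matrix.transvection q p 1) = _
      rw [Lsp_tr _ _ _ _ hpq.symm, Lsp_tr _ _ _ _ hpq]
      · simp only [p, q]; omega
      · simp only [p, q]; omega
    have hγ'S : γ' ∈ S := fun j hj => (hγS j hj).trans (hLs j (by rintro rfl; exact hpJ hj))
    have hle := hγmin γ' hγ'S
    have hmem : p' + 1 ∈ Finset.Ioo 0 n := by simp; omega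
    have hP1 : P γ = D (p' + 1) * ∏ k ∈ (Finset.Ioo 0 n).erase (p' + 1), D k :=
      (Finset.mul_prod_erase _ _ hmem).symm
    have hP2 : P γ' = lgm (p' + 1) (HG h γ') * ∏ k ∈ (Finset.Ioo 0 n).erase (p' + 1), D k := by
      change ∏ k ∈ Finset.Ioo 0 n, lgm k (HG h γ') = _
      rw [← Finset.mul_prod_erase _ _ hmem]
      congr 1
      apply Finset.prod_congr rfl
      intro k hk
      exact (lgm_congr k h γ γ' (hLs k (Finset.ne_of_mem_erase hk))).symm
    have hQ : 0 < ∏ k ∈ (Finset.Ioo 0 n).erase (p' + 1), D k := Finset.prod_pos fun k _ => hDpos k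
    rw [hP1, hP2, ← mul_assoc] at hle
    have hle2 := le_of_mul_le_mul_right hle hQ
    have hcolne : ∀ l j, j < p → γ'.1 l j = γ.1 l j := by
      intro l j hj
      change (γ.1 * Matrix.transvection p q (-m) * Matrix.transvection q p 1 : Matrix (Fin n) (Fin n) ℤ) l j = _
      have h1 : j ≠ p := hj.ne
      have h2 : j ≠ q := by
        rintro rfl
        simp [p, q, Fin.lt_def] at hj
      rw [Matrix.mul_transvection_apply_of_ne _ _ _ _ h1,
        Matrix.mul_transvection_apply_of_ne _ _ _ _ h2]
    have hcolp : ∀ l, γ'.1 l p = γ.1 l q + (1 - m) * γ.1 l p := by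
      intro l
      change (γ.1 * Matrix.transvection p q (-m) * Matrix.transvection q p 1 : Matrix (Fin n) (Fin n) ℤ) l p = _
      rw [Matrix.mul_transvection_apply_same, Matrix.mul_transvection_apply_same,
        Matrix.mul_transvection_apply_of_ne _ _ _ _ hpq]
      ring
    have hsw := hm (HG h γ') (by
        intro j hj
        ext a
        simp only [cv, HG, Matrix.mul_apply, Matrix.map_apply, hcolne _ j hj]) (by
        ext a
        simp only [cv, HG, Matrix.mul_apply, Matrix.map_apply, hcolp, PiLp.add_apply,
          PiLp.smul_apply, smul_eq_mul, Finset.mul_sum, ← Finset.sum_add_distrib]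
        apply Finset.sum_congr rfl
        intro l _
        simp
        ring)
    have e1 := hDs p
    have e2 := hDs q
    change lgm (p' + 1) (HG h γ') ≤ D p' * (‖g q‖ ^ 2 + ‖g p‖ ^ 2 / 4) at hsw
    change D (p' + 1) = D p' * ‖g p‖ ^ 2 at e1
    change D (p' + 2) = D (p' + 1) * ‖g q‖ ^ 2 at e2
    have h5 : D (p' + 1) * (5 / 8) ≤ 3 / 2 * (D p' * ‖g q‖ ^ 2) := by
      nlinarith
    have h6 : 0 ≤ D p' * ‖g q‖ ^ 2 := mul_nonneg (hDpos _).le (sq_nonneg _)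
    rw [e2]
    have h7 : D (p' + 1) ≤ 4 * (D p' * ‖g q‖ ^ 2) := by linarith
    nlinarith [mul_le_mul_of_nonneg_left h7 (hDpos (p' + 1)).le]
  have hDup : ∀ k ≤ n, D k ≤ 4 ^ (n ^ 2) := by
    let E : ℕ → ℝ := fun k => D k * 4 ^ (k ^ 2)
    obtain ⟨k, hk, hmax⟩ := Finset.exists_max_image (Finset.range (n + 1)) E ⟨0, by simp⟩
    have hkn : k ≤ n := by simpa [Nat.lt_succ_iff] using hk
    have hEk : E k ≤ 4 ^ (n ^ 2) := by
      have hDk : D k ≤ 1 → E k ≤ 4 ^ (n ^ 2) := by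
        intro h1
        calc E k ≤ 1 * 4 ^ (k ^ 2) := by simp only [E]; gcongr
          _ ≤ 4 ^ (n ^ 2) := by
            rw [one_mul]; exact pow_le_pow_right₀ (by norm_num) (Nat.pow_le_pow_left hkn 2)
      by_cases hkJ : k ∈ J
      · apply hDk
        have := hJ k hkJ
        rwa [lgm_congr k h γ0 γ (hγS k hkJ)] at this
      rcases Nat.eq_zero_or_pos k with h0 | h0
      · apply hDk; rw [h0]; exact (lgm_zero _).le
      rcases hkn.eq_or_lt with h1 | h1
      · apply hDk; rw [h1]; exact (lgm_top _ (HG_det h γ)).le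
      exfalso
      obtain ⟨p, rfl⟩ : ∃ p, k = p + 1 := ⟨k - 1, by omega⟩
      have hc := hconv p h1 hkJ
      have m1 := hmax p (by simp; omega)
      have m2 := hmax (p + 2) (by simp; omega)
      have hpw : ((4:ℝ) ^ ((p + 1) ^ 2)) ^ 2 * 16 = 4 ^ (p ^ 2) * 4 ^ ((p + 2) ^ 2) := by
        rw [show (16:ℝ) = 4 ^ 2 by norm_num, ← pow_mul, ← pow_add, ← pow_add]
        congr 1; ring
      have hE0 : ∀ k, 0 < E k := fun k => mul_pos (hDpos k) (by positivity)
      have h8 : E (p + 1) ^ 2 * 16 ≤ 4 * (E p * E (p + 2)) := by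
        calc E (p + 1) ^ 2 * 16 = D (p + 1) ^ 2 * (((4:ℝ) ^ ((p + 1) ^ 2)) ^ 2 * 16) := by
              simp only [E]; ring
          _ ≤ (4 * D p * D (p + 2)) * (4 ^ (p ^ 2) * 4 ^ ((p + 2) ^ 2)) := by
              rw [hpw]; gcongr
          _ = _ := by simp only [E]; ring
      have h9 : E p * E (p + 2) ≤ E (p + 1) * E (p + 1) :=
        mul_le_mul m1 m2 (hE0 _).le (hE0 _).le
      nlinarith [hE0 (p + 1)]
    intro j hj
    have h1 := (hmax j (by simp; omega)).trans hEk
    have h2 : (1:ℝ) ≤ 4 ^ (j ^ 2) := one_le_pow₀ (by norm_num)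
    have := hDpos j
    simp only [E] at h1
    nlinarith
  have hDlow : ∀ k < n, ε ≤ D k := by
    intro k hk
    rcases Nat.eq_zero_or_pos k with h0 | h0
    · rw [h0]; simpa [hD, lgm_zero] using hε1
    · exact hlow k (by simp; omega) γ hγS
  have hgr : ∀ j, ‖g j‖ ≤ r := by
    intro j
    rw [hr]
    apply Real.le_sqrt_of_sq_le
    rw [le_div_iff₀ hε]
    have h1 := hDs j
    have h2 := hDup (j + 1) j.2
    have h3 := hDlow j j.2
    nlinarith [sq_nonneg ‖g j‖]
  have hsr : ∀ j : Fin n, ∃ c : Fin n → ℤ, (∀ i : Fin n, j ≤ i → c i = 0) ∧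
      ‖(cv (HG h γ) j - g j) - ∑ i, (c i : ℝ) • cv (HG h γ) i‖ ≤ (j : ℕ) * r := by
    intro j
    obtain ⟨c, hc, hc2⟩ := size_red (cv (HG h γ)) r hgr j j.2.le (cv (HG h γ) j - g j)
      (gs_sub_mem (cv (HG h γ)) j)
    exact ⟨c, fun i hi => hc i hi, hc2⟩
  choose c hc0 hc using hsr
  let Cm : Matrix (Fin n) (Fin n) ℤ := Matrix.of fun i j => c j i
  let γ1 : SL(n, ℤ) := ⟨γ.1 * (1 - Cm), by
    rw [Matrix.det_mul, γ.2, one_mul, Matrix.det_of_isUpperTriangular]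
    · apply Finset.prod_eq_one
      intro i _
      simp [Cm, hc0 i i le_rfl]
    · intro i j hij
      have hij' : j < i := hij
      simp [Cm, hc0 j i hij'.le, Matrix.one_apply_ne hij'.ne']⟩
  refine ⟨γ1, ?_⟩
  intro a j
  have hr0 : 0 ≤ r := Real.sqrt_nonneg _
  have hcol : cv (HG h γ1) j = (cv (HG h γ) j - g j - ∑ i, (c j i : ℝ) • cv (HG h γ) i) + g j := by
    have h1 : cv (HG h γ1) j = cv (HG h γ) j - ∑ i, (c j i : ℝ) • cv (HG h γ) i := by
      have hmat : HG h γ1 = HG h γ - HG h γ * Cm.map (Int.castRingHom ℝ) := by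
        have : γ1.1 = γ.1 - γ.1 * Cm := by
          change γ.1 * (1 - Cm) = _
          rw [Matrix.mul_sub, Matrix.mul_one]
        rw [HG, this, HG, Matrix.mul_assoc, ← Matrix.map_mul, ← Matrix.mul_sub]
        congr 1
        ext; simp
      ext b
      simp only [cv, hmat, Matrix.sub_apply, PiLp.sub_apply]
      rw [Matrix.mul_apply]
      congr 1
      simp [WithLp.ofLp_sum, Finset.sum_apply, Cm, mul_comm]
    rw [h1]; abel
  have hnorm : ‖cv (HG h γ1) j‖ ≤ n * r + r := by
    rw [hcol]
    refine (norm_add_le _ _).trans (add_le_add ((hc j).trans ?_) (hgr j))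
    gcongr
    exact j.2.le
  have := PiLp.norm_apply_le (cv (HG h γ1) j) a
  exact this.trans hnorm

lemma lgm_map {R S : Type*} [CommRing R] [CommRing S] {n : ℕ} (φ : R →+* S) (k : ℕ)
    (A : Matrix (Fin n) (Fin n) R) : φ (lgm k A) = lgm k (A.map φ) := by
  rw [lgm, lgm, RingHom.map_det]
  congr 1
  ext i j
  simp [Matrix.mul_apply]

lemma one_le_lgm {n : ℕ} (k : ℕ) (γ : SL(n, ℤ)) : 1 ≤ lgm k (γ.1.map (Int.castRingHom ℝ)) := by
  have h := lgm_pos k (γ.1.map (Int.castRingHom ℝ)) (by rw [det_cast]; exact one_ne_zero)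
  rw [← lgm_map] at h ⊢
  simp only [eq_intCast] at h ⊢
  have : (0:ℤ) < lgm k γ.1 := by exact_mod_cast h
  exact_mod_cast this

open InnerProductSpace in
lemma lgm_lower {n : ℕ} (g : SL(n, ℝ)) : ∃ ρ : ℝ, 0 < ρ ∧ ρ ≤ 1 ∧ ∀ (k : ℕ) (γ : SL(n, ℤ)),
    ρ ≤ lgm k (HG g γ) := by
  let L := Matrix.toEuclideanLin g.1
  let Li := LinearMap.toContinuousLinearMap (Matrix.toEuclideanLin (g⁻¹).1)
  have hLi : ∀ v, Li (L v) = v := by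
    intro v
    have h1 : (g⁻¹).1 * g.1 = 1 := by
      exact congrArg Subtype.val (inv_mul_cancel g)
    change WithLp.toLp 2 ((g⁻¹).1 *ᵥ (g.1 *ᵥ v.ofLp)) = v
    rw [Matrix.mulVec_mulVec, h1, Matrix.one_mulVec]
  set C := ‖Li‖ + 1 with hC
  have hC1 : 1 ≤ C := by have := norm_nonneg Li; linarith
  have hbd : ∀ v, C⁻¹ * ‖v‖ ≤ ‖L v‖ := by
    intro v
    rw [inv_mul_le_iff₀ (by linarith)]
    calc ‖v‖ = ‖Li (L v)‖ := by rw [hLi]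
      _ ≤ ‖Li‖ * ‖L v‖ := Li.le_opNorm _
      _ ≤ C * ‖L v‖ := by gcongr; linarith
  have hCi : 0 < C⁻¹ := by positivity
  have hCi1 : C⁻¹ ≤ 1 := inv_le_one_of_one_le₀ hC1
  refine ⟨(C⁻¹ ^ 2) ^ n, by positivity, pow_le_one₀ (by positivity) (pow_le_one₀ hCi.le hCi1), ?_⟩
  intro k γ
  set A := γ.1.map (Int.castRingHom ℝ) with hA
  have hcv : cv (HG g γ) = L ∘ cv A := by
    funext j
    ext a
    simp [L, cv, HG, Matrix.mul_apply, Matrix.mulVec, dotProduct, hA]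
  have hgs : ∀ j, C⁻¹ * ‖gramSchmidt ℝ (cv A) j‖ ≤ ‖gramSchmidt ℝ (cv (HG g γ)) j‖ := by
    intro j
    have h1 := gs_sub_mem (cv (HG g γ)) j
    rw [hcv, Set.image_comp, Submodule.span_image] at h1
    obtain ⟨w, hw, hw2⟩ := h1
    have h2 : gramSchmidt ℝ (cv (HG g γ)) j = L (cv A j - w) := by
      rw [map_sub, hw2, hcv]
      simp
    rw [h2]
    refine le_trans ?_ (hbd _)
    exact mul_le_mul_of_nonneg_left (gs_norm_le (cv A) j w hw) hCi.le
  have h3 : (C⁻¹ ^ 2) ^ n ≤ (C⁻¹ ^ 2) ^ (Fintype.card {i : Fin n // (i : ℕ) < k}) := by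
    apply pow_le_pow_of_le_one (by positivity) (pow_le_one₀ hCi.le hCi1)
    calc _ ≤ Fintype.card (Fin n) := Fintype.card_subtype_le _
      _ = n := Fintype.card_fin n
  have h4 := one_le_lgm k γ
  calc (C⁻¹ ^ 2) ^ n ≤ (C⁻¹ ^ 2) ^ (Fintype.card {i : Fin n // (i : ℕ) < k}) := h3
    _ ≤ (C⁻¹ ^ 2) ^ (Fintype.card {i : Fin n // (i : ℕ) < k}) * lgm k A :=
        le_mul_of_one_le_right (by positivity) h4
    _ = ∏ i : {i : Fin n // (i : ℕ) < k}, (C⁻¹ * ‖gramSchmidt ℝ (cv A) i‖) ^ 2 := by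
        rw [lgm_eq]
        simp only [mul_pow]
        rw [Finset.prod_mul_distrib, Finset.prod_const, Finset.card_univ]
    _ ≤ lgm k (HG g γ) := by
        rw [lgm_eq]
        refine Finset.prod_le_prod (fun _ _ => by positivity) fun i _ => ?_
        have := hgs i
        gcongr

lemma natDegree_det_le {ι : Type*} [Fintype ι] [DecidableEq ι] (A : Matrix ι ι (Polynomial ℝ)) (d : ℕ)
    (h : ∀ i j, (A i j).natDegree ≤ d) : A.det.natDegree ≤ Fintype.card ι * d := by
  rw [Matrix.det_apply']
  apply Polynomial.natDegree_sum_le_of_forall_le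
  intro σ _
  refine Polynomial.natDegree_mul_le.trans ?_
  rw [Polynomial.natDegree_intCast, zero_add]
  refine (Polynomial.natDegree_prod_le _ _).trans ?_
  calc _ ≤ ∑ i : ι, d := Finset.sum_le_sum fun i _ => h _ _
    _ = _ := by simp

lemma natDegree_mul_mat_le {n : ℕ} (A B : Matrix (Fin n) (Fin n) (Polynomial ℝ)) (d e : ℕ)
    (h : ∀ i j, (A i j).natDegree ≤ d) (h' : ∀ i j, (B i j).natDegree ≤ e) (i j : Fin n) :
    ((A * B) i j).natDegree ≤ d + e := by
  rw [Matrix.mul_apply]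
  apply Polynomial.natDegree_sum_le_of_forall_le
  intro l _
  exact Polynomial.natDegree_mul_le.trans (add_le_add (h _ _) (h' _ _))

lemma natDegree_lgm_le {n : ℕ} (k : ℕ) (A : Matrix (Fin n) (Fin n) (Polynomial ℝ)) (d : ℕ)
    (h : ∀ i j, (A i j).natDegree ≤ d) : (lgm k A).natDegree ≤ n * (d + d) := by
  rw [lgm]
  refine (natDegree_det_le _ (d + d) ?_).trans ?_
  · intro i j
    exact natDegree_mul_mat_le Aᵀ A d d (fun i j => h j i) h _ _
  · gcongr
    calc _ ≤ Fintype.card (Fin n) := Fintype.card_subtype_le _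
      _ = n := Fintype.card_fin n

lemma unip_poly_nat {n : ℕ} (u : ℝ → SL(n, ℝ))
    (hu_hom : ∀ s t : ℝ, u (s + t) = u s * u t)
    (hu_unip : ∀ t : ℝ, IsNilpotent ((u t : Matrix (Fin n) (Fin n) ℝ) - 1)) (s : ℝ) (i j : Fin n) :
    ∃ p : Polynomial ℝ, ∀ m : ℕ, p.eval (m : ℝ) = (u (m * s)).1 i j := by
  obtain ⟨d, hd⟩ := hu_unip s
  set M := (u s : Matrix (Fin n) (Fin n) ℝ) - 1 with hM
  have hu0 : u 0 = 1 := by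
    have := hu_hom 0 0
    rw [add_zero] at this
    exact left_eq_mul.1 this
  have hpow : ∀ m : ℕ, (u (m * s)).1 = (u s).1 ^ m := by
    intro m
    induction m with
    | zero => simp [hu0]
    | succ m ih =>
      rw [show ((m + 1 : ℕ) : ℝ) * s = m * s + s by push_cast; ring, hu_hom, pow_succ, ← ih]
      rfl
  refine ⟨∑ l ∈ Finset.range d, Polynomial.C ((M ^ l) i j / (l.factorial : ℝ)) *
    descPochhammer ℝ l, ?_⟩
  intro m
  have h1 : (u s).1 = M + 1 := by rw [hM]; simp
  rw [hpow, h1, (Commute.one_right M).add_pow]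
  have h2 : ∑ l ∈ Finset.range (m + 1), M ^ l * 1 ^ (m - l) * ((m.choose l : ℕ) : Matrix (Fin n) (Fin n) ℝ)
      = ∑ l ∈ Finset.range d, (m.choose l : ℝ) • M ^ l := by
    have e1 : ∀ l, M ^ l * 1 ^ (m - l) * ((m.choose l : ℕ) : Matrix (Fin n) (Fin n) ℝ) =
        (m.choose l : ℝ) • M ^ l := by
      intro l
      rw [one_pow, mul_one, ← nsmul_eq_mul', Nat.cast_smul_eq_nsmul]
    simp only [e1]
    have e2 : ∀ N, m + 1 ≤ N → ∑ l ∈ Finset.range (m + 1), (m.choose l : ℝ) • M ^ l =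
        ∑ l ∈ Finset.range N, (m.choose l : ℝ) • M ^ l := by
      intro N hN
      apply Finset.sum_subset (Finset.range_subset_range.2 hN)
      intro l _ hl
      rw [Nat.choose_eq_zero_of_lt (by simpa [Nat.succ_le_iff] using hl)]; simp
    have e3 : ∀ N, d ≤ N → ∑ l ∈ Finset.range d, (m.choose l : ℝ) • M ^ l =
        ∑ l ∈ Finset.range N, (m.choose l : ℝ) • M ^ l := by
      intro N hN
      apply Finset.sum_subset (Finset.range_subset_range.2 hN)
      intro l _ hl
      rw [pow_eq_zero_of_le (by simpa using hl) hd, smul_zero]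
    rw [e2 (m + 1 + d) (by omega), e3 (m + 1 + d) (by omega)]
  rw [h2, Polynomial.eval_finsetSum, Matrix.sum_apply]
  apply Finset.sum_congr rfl
  intro l _
  rw [Polynomial.eval_mul, Polynomial.eval_C, Matrix.smul_apply, Nat.cast_choose_eq_descPochhammer_div,
    smul_eq_mul]
  ring

lemma unip_poly {n : ℕ} (u : ℝ → SL(n, ℝ))
    (hu_hom : ∀ s t : ℝ, u (s + t) = u s * u t) (hu_cont : Continuous u)
    (hu_unip : ∀ t : ℝ, IsNilpotent ((u t : Matrix (Fin n) (Fin n) ℝ) - 1)) (i j : Fin n) :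
    ∃ p : Polynomial ℝ, ∀ t : ℝ, 0 ≤ t → p.eval t = (u t).1 i j := by
  have key := fun s => unip_poly_nat u hu_hom hu_unip s i j
  choose P hP using key
  refine ⟨P 1, ?_⟩
  have hrat : ∀ k m : ℕ, 0 < m → (P 1).eval ((k : ℝ) / m) = (u ((k : ℝ) / m)).1 i j := by
    intro k m hm
    have hm' : (m : ℝ) ≠ 0 := by positivity
    have heq : (P (1 / m)).comp (Polynomial.C (m : ℝ) * Polynomial.X) = P 1 := by
      apply Polynomial.eq_of_infinite_eval_eq
      apply Set.Infinite.mono (s := Set.range ((↑) : ℕ → ℝ))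
      · rintro _ ⟨x, rfl⟩
        have h1 := hP 1 x
        have h2 := hP (1 / m) (m * x)
        simp only [Set.mem_ofPred_eq, Polynomial.eval_comp, Polynomial.eval_mul, Polynomial.eval_C,
          Polynomial.eval_X]
        push_cast at h2
        rw [h1, h2]
        field_simp
      · exact Set.infinite_range_of_injective Nat.cast_injective
    rw [← heq]
    simp only [Polynomial.eval_comp, Polynomial.eval_mul, Polynomial.eval_C, Polynomial.eval_X]
    rw [mul_div_cancel₀ _ hm', hP]
    field_simp
  intro t ht
  have hlim : Tendsto (fun m : ℕ => ((⌊t * (m : ℝ)⌋₊ : ℕ) : ℝ) / (m : ℝ)) atTop (nhds t) :=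
    (tendsto_nat_floor_mul_div_atTop ht).comp tendsto_natCast_atTop_atTop
  have hc : Continuous fun t => (u t).1 i j :=
    (continuous_subtype_val.comp hu_cont).matrix_elem i j
  have h1 := ((P 1).continuous.tendsto t).comp hlim
  have h2 := (hc.tendsto t).comp hlim
  refine tendsto_nhds_unique h1 (h2.congr' ?_)
  filter_upwards [eventually_gt_atTop 0] with m hm
  exact (hrat _ m hm).symm

/-- **Margulis**: no orbit of a one-parameter unipotent subgroup on
`SL(n,ℝ)/SL(n,ℤ)` diverges to infinity. -/
theorem unipotent_orbit_not_divergent (n : ℕ) (u : ℝ → SL(n, ℝ))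
    (hu_hom : ∀ s t : ℝ, u (s + t) = u s * u t) (hu_cont : Continuous u)
    (hu_unip : ∀ t : ℝ, IsNilpotent ((u t : Matrix (Fin n) (Fin n) ℝ) - 1))
    (a : SL(n, ℝ) ⧸ SLZ n) :
    ¬ Tendsto (fun t : ℝ => u t • a) atTop (cocompact (SL(n, ℝ) ⧸ SLZ n)) := by
  intro htend
  obtain ⟨g, rfl⟩ := QuotientGroup.mk_surjective a
  have hu0 : u 0 = 1 := by
    have := hu_hom 0 0
    rw [add_zero] at this
    exact left_eq_mul.1 this
  have hpoly := fun i j => unip_poly u hu_hom hu_cont hu_unip i j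
  choose U hU using hpoly
  let d : ℕ := ∑ i, ∑ j, (U i j).natDegree
  have hd : ∀ i j, (U i j).natDegree ≤ d := fun i j =>
    (Finset.single_le_sum (f := fun j => (U i j).natDegree) (fun _ _ => Nat.zero_le _)
      (Finset.mem_univ j)).trans
    (Finset.single_le_sum (f := fun i => ∑ j, (U i j).natDegree) (fun _ _ => Nat.zero_le _)
      (Finset.mem_univ i))
  let f : ℕ → SL(n, ℤ) → Polynomial ℝ := fun k γ =>
    lgm k (Matrix.of U * (HG g γ).map Polynomial.C)
  have hf : ∀ k γ (z : ℝ), 0 ≤ z → (f k γ).eval z = lgm k (HG (u z * g) γ) := by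
    intro k γ z hz
    change (Polynomial.evalRingHom z) (lgm k (Matrix.of U * (HG g γ).map Polynomial.C)) = _
    rw [lgm_map, Matrix.map_mul]
    congr 1
    have e1 : (Matrix.of U).map (Polynomial.evalRingHom z) = (u z).1 := by
      ext i j
      simp [hU i j z hz]
    have e2 : ((HG g γ).map Polynomial.C).map (Polynomial.evalRingHom z) = HG g γ := by
      ext i j
      simp
    rw [e1, e2, HG, HG, ← Matrix.mul_assoc]
    rfl
  have hdeg : ∀ k γ, (f k γ).natDegree ≤ n * (d + d) := by
    intro k γ
    apply natDegree_lgm_le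
    intro i j
    exact natDegree_mul_mat_le _ _ d 0 hd (fun i j => by simp) i j
  obtain ⟨c, hc0, hc1, hkm⟩ := km (Finset.Ioo 0 n)
    (fun k (γ γ' : SL(n, ℤ)) => Lsp k γ.1 = Lsp k γ'.1) (fun _ _ => rfl)
    (fun _ _ _ _ h1 h2 => h1.trans h2) f (n * (d + d)) hdeg
    (fun k γ z hz => by rw [hf k γ z hz]; exact lgm_nonneg _ _)
    (fun k γ γ' hL z hz => by rw [hf k γ z hz, hf k γ' z hz]; exact lgm_congr k _ γ γ' hL)
    (Finset.Ioo 0 n \ ∅).card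
  obtain ⟨ρ0, hρ0, hρ1, hlow⟩ := lgm_lower g
  obtain ⟨C, hC, hrem⟩ := remez' (n * (d + d)) (1 / 2) (by norm_num)
  set ρ := ρ0 / (2 * C) with hρ
  have hρpos : 0 < ρ := by positivity
  have hρle : ρ ≤ 1 := by
    rw [hρ, div_le_one (by positivity)]; linarith
  obtain ⟨R, hR⟩ := reduce n (c * ρ) (by positivity) (by nlinarith)
  let Kc : Set SL(n, ℝ) := {h | ∀ i j, |h.1 i j| ≤ R}
  have hKc : IsCompact Kc := by
    have hemb : Topology.IsClosedEmbedding
        (Subtype.val : SL(n, ℝ) → Matrix (Fin n) (Fin n) ℝ) := by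
      apply IsClosed.isClosedEmbedding_subtypeVal
      exact isClosed_eq (continuous_id.matrix_det) continuous_const
    have hbox : IsCompact {M : Matrix (Fin n) (Fin n) ℝ | ∀ i j, |M i j| ≤ R} := by
      have h1 : IsCompact (Set.univ.pi fun _ : Fin n => Set.univ.pi fun _ : Fin n => Set.Icc (-R) R) :=
        isCompact_univ_pi fun _ => isCompact_univ_pi fun _ => isCompact_Icc
      have h2 : {M : Matrix (Fin n) (Fin n) ℝ | ∀ i j, |M i j| ≤ R} =
          (Set.univ.pi fun _ : Fin n => Set.univ.pi fun _ : Fin n => Set.Icc (-R) R) := by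
        ext M
        constructor
        · intro h i _ j _
          exact abs_le.1 (h i j)
        · intro h i j
          exact abs_le.2 (h i trivial j trivial)
      rw [h2]
      exact h1
    exact hemb.isCompact_preimage hbox
  have hK : IsCompact ((QuotientGroup.mk : SL(n, ℝ) → SL(n, ℝ) ⧸ SLZ n) '' Kc) :=
    hKc.image continuous_quotient_mk'
  have hev := htend hK.compl_mem_cocompact
  obtain ⟨T0, hT0⟩ := (eventually_atTop.1 (hev : ∀ᶠ t in atTop, u t • (g : SL(n, ℝ) ⧸ SLZ n) ∈ _))
  set T := max T0 1 with hT
  have hT1 : 1 ≤ T := le_max_right _ _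
  obtain ⟨z, hz, J, -, γ1, -, hsm, hlg⟩ := hkm ∅ rfl 1 T (2 * T) ρ (by linarith) (by linarith) hρpos (by
    intro k _ γ _
    refine hrem (f k γ) (hdeg k γ) 0 (2 * T) T (2 * T) ρ0 (by linarith) le_rfl (by linarith)
      (by linarith) hρ0 (fun y hy => ?_) ⟨0, ⟨le_rfl, by linarith⟩, ?_⟩
    · rw [hf k γ y hy.1]; exact lgm_nonneg _ _
    · rw [hf k γ 0 le_rfl, hu0, one_mul]; exact hlow k γ)
  have hz0 : 0 ≤ z := by linarith [hz.1]
  obtain ⟨γ, hγ⟩ := hR (u z * g) γ1 J (by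
    intro k hk
    rw [← hf k γ1 z hz0]
    exact (hsm k (by simpa using hk)).trans hρle) (by
    intro k hk γ hγ
    rw [← hf k γ z hz0]
    exact hlg k (by simpa using hk) γ hγ)
  refine hT0 z ((le_max_left _ _).trans hz.1) ?_
  refine ⟨u z * g * Matrix.SpecialLinearGroup.map (Int.castRingHom ℝ) γ, ?_, ?_⟩
  · intro i j
    exact hγ i j
  · change _ = ((u z * g : SL(n, ℝ)) : SL(n, ℝ) ⧸ SLZ n)
    apply QuotientGroup.mk_mul_of_mem
    exact ⟨γ, rfl⟩
end

section
/- Let G = SL(n,ℝ), Γ the image of SL(n,ℤ) in G, and let u : ℝ → G be a one-parameter unipotent subgroup. Then for every a ∈ G/Γ and every ε > 0, there exists a compact subset K ⊆ G/Γ such that limsup_{T→∞} (1/T)·λ({t ∈ [0,T] : u(t)·a ∉ K}) < ε, where λ denotes Lebesgue measure on ℝ. -/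
open Matrix MatrixGroups Filter MeasureTheory

lemma dn_sep (S : Set ℝ) (δ : ℝ) (hδ : 0 < δ) (m : ℕ) (hS : ENNReal.ofReal (m * (2 * δ)) < volume S) :
    ∀ k ≤ m + 1, ∃ s : Finset ℝ, (s : Set ℝ) ⊆ S ∧ s.card = k ∧
      ∀ x ∈ s, ∀ y ∈ s, x ≠ y → δ ≤ |x - y| := by
  intro k
  induction k with
  | zero => intro _; exact ⟨∅, by simp, by simp, by simp⟩
  | succ k ih =>
    intro hk
    obtain ⟨s, hsS, hc, hsep⟩ := ih (by omega)
    have hv : volume (⋃ x ∈ s, Metric.ball x δ) ≤ ENNReal.ofReal (m * (2 * δ)) := by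
      refine (measure_biUnion_finset_le _ _).trans ?_
      simp only [Real.volume_ball, Finset.sum_const, hc, nsmul_eq_mul]
      rw [ENNReal.ofReal_mul (p := (m : ℝ)) (by positivity), ENNReal.ofReal_natCast]
      gcongr
      omega
    have hns : ¬ S ⊆ ⋃ x ∈ s, Metric.ball x δ := fun h =>
      absurd (lt_of_lt_of_le hS ((measure_mono h).trans hv)) (lt_irrefl _)
    obtain ⟨y, hyS, hy⟩ := Set.not_subset.1 hns
    simp only [Set.mem_iUnion, Metric.mem_ball, Real.dist_eq, not_exists, not_lt] at hy
    have hys : y ∉ s := fun h => by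
      have := hy y h
      simp at this; linarith
    refine ⟨insert y s, ?_, by rw [Finset.card_insert_of_notMem hys, hc], ?_⟩
    · intro x hx
      simp only [Finset.coe_insert, Set.mem_insert_iff] at hx
      rcases hx with rfl | hx
      · exact hyS
      · exact hsS hx
    · intro a ha b hb hab
      rw [Finset.mem_insert] at ha hb
      rcases ha with rfl | ha <;> rcases hb with rfl | hb
      · exact absurd rfl hab
      · exact hy b hb
      · rw [abs_sub_comm]; exact hy a ha
      · exact hsep a ha b hb hab

lemma dn_poly_small (D : ℕ) (ρ : ℝ) (hρ : 0 < ρ) (η : ℝ) (hη : 0 < η) :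
    ∃ ε : ℝ, 0 < ε ∧ ε ≤ ρ ∧ ∀ p : Polynomial ℝ, p.natDegree ≤ D → ∀ z r : ℝ, 0 < r →
      (∃ x ∈ Metric.closedBall z r, ρ ≤ p.eval x) →
      volume {x | x ∈ Metric.closedBall z r ∧ |p.eval x| < ε} ≤ ENNReal.ofReal (η * r) := by
  set Q : ℝ := (D + 1) * (1 + 4 * (D + 1) / η) ^ D with hQ
  have hQ1 : 1 ≤ Q := by
    have : 1 ≤ (1 + 4 * (D + 1) / η : ℝ) ^ D := one_le_pow₀ (by
      have : 0 ≤ 4 * (D + 1) / η := by positivity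
      linarith)
    have h2 : (0:ℝ) ≤ D := by positivity
    nlinarith
  refine ⟨ρ / (2 * Q), by positivity, ?_, ?_⟩
  · rw [div_le_iff₀ (by positivity)]; nlinarith
  intro p hp z r hr ⟨x, hx, hpx⟩
  by_contra hcon
  rw [not_le] at hcon
  set δ : ℝ := η * r / (2 * (D + 1)) with hδ
  have hδ0 : 0 < δ := by positivity
  obtain ⟨s, hsS, hc, hsep⟩ := dn_sep {x | x ∈ Metric.closedBall z r ∧ |p.eval x| < ρ / (2 * Q)} δ hδ0 D
    (lt_of_le_of_lt (ENNReal.ofReal_le_ofReal (by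
      rw [hδ]; field_simp; nlinarith [mul_pos hη hr])) hcon) (D + 1) le_rfl
  have hint : p = Lagrange.interpolate s id (fun i => p.eval i) := by
    have := Lagrange.eq_interpolate (s := s) (v := id) (f := p) (by simp)
      (by rw [hc]
          refine lt_of_le_of_lt Polynomial.degree_le_natDegree ?_
          exact_mod_cast Nat.lt_succ_of_le hp)
    simpa using this
  have hev : p.eval x = ∑ i ∈ s, p.eval i * ∏ j ∈ s.erase i, ((i - j)⁻¹ * (x - j)) := by
    conv_lhs => rw [hint]
    rw [Lagrange.interpolate_apply, Polynomial.eval_finsetSum]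
    refine Finset.sum_congr rfl fun i hi => ?_
    simp [Lagrange.basis, Lagrange.basisDivisor, Polynomial.eval_prod]
  have hb : |p.eval x| ≤ ∑ i ∈ s, ρ / (2 * Q) * (1 + 4 * (D + 1) / η) ^ D := by
    rw [hev]
    refine (Finset.abs_sum_le_sum_abs _ _).trans (Finset.sum_le_sum fun i hi => ?_)
    rw [abs_mul, Finset.abs_prod]
    refine mul_le_mul (hsS hi).2.le ?_ (Finset.prod_nonneg fun _ _ => abs_nonneg _) (by positivity)
    have hcard : (s.erase i).card = D := by rw [Finset.card_erase_of_mem hi, hc]; rfl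
    have hle : ∏ j ∈ s.erase i, |(i - j)⁻¹ * (x - j)| ≤
        ∏ _j ∈ s.erase i, (1 + 4 * (D + 1) / η : ℝ) := by
      refine Finset.prod_le_prod (fun _ _ => abs_nonneg _) fun j hj => ?_
      have hj' := Finset.mem_erase.1 hj
      have h1 := hsep i hi j hj'.2 (Ne.symm hj'.1)
      have h2 : |x - j| ≤ 2 * r := by
        have h3 := (hsS hj'.2).1
        rw [Metric.mem_closedBall, Real.dist_eq] at h3 hx
        rw [abs_le] at *
        constructor <;> linarith [h3.1, h3.2, hx.1, hx.2]
      have h4 : |(i - j)⁻¹ * (x - j)| ≤ δ⁻¹ * (2 * r) := by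
        rw [abs_mul, abs_inv]
        gcongr
      have h5 : δ⁻¹ * (2 * r) = 4 * (D + 1) / η := by
        rw [hδ]; field_simp; ring
      linarith
    rw [Finset.prod_const, hcard] at hle
    exact hle
  rw [Finset.sum_const, hc, nsmul_eq_mul] at hb
  have : ((D + 1 : ℕ) : ℝ) * (ρ / (2 * Q) * (1 + 4 * (D + 1) / η) ^ D) = ρ / 2 := by
    have : ((D + 1 : ℕ) : ℝ) * (ρ / (2 * Q) * (1 + 4 * (D + 1) / η) ^ D) = Q * (ρ / (2 * Q)) := by
      rw [hQ]; push_cast; ring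
    rw [this]; field_simp
  rw [this] at hb
  have := le_abs_self (p.eval x)
  linarith


def DnMarked {P : Type*} [PartialOrder P] (f : P → ℝ → ℝ) (ε ρ : ℝ) (S : Set P) (x : ℝ) : Prop :=
  ∃ F : Set P, F ⊆ S ∧ IsChain (· ≤ ·) F ∧ (∀ s ∈ F, ε ≤ f s x ∧ f s x ≤ ρ) ∧
    ∀ s ∈ S, (∀ t ∈ F, s ≤ t ∨ t ≤ s) → s ∈ F ∨ ρ ≤ f s x

lemma dn_sum_balls {β : Type*} (s : Set β) (c r : β → ℝ) (hr : ∀ b, 0 < r b)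
    (hd : s.PairwiseDisjoint fun j => Metric.closedBall (c j) (r j)) (z R : ℝ)
    (hsub : ∀ b, Metric.closedBall (c b) (r b) ⊆ Metric.closedBall z R) :
    s.Countable ∧ ∑' j : s, ENNReal.ofReal (r j) ≤ ENNReal.ofReal R := by
  have hcount : s.Countable := by
    refine Set.PairwiseDisjoint.countable_of_nonempty_interior hd fun b _ => ?_
    exact ⟨c b, Metric.ball_subset_interior_closedBall (Metric.mem_ball_self (hr b))⟩
  refine ⟨hcount, ?_⟩
  have h1 : volume (⋃ j ∈ s, Metric.closedBall (c j) (r j)) =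
      ∑' j : s, volume (Metric.closedBall (c j) (r j)) :=
    measure_biUnion hcount hd fun b _ => Metric.isClosed_closedBall.measurableSet
  have h2 : volume (⋃ j ∈ s, Metric.closedBall (c j) (r j)) ≤ volume (Metric.closedBall z R) :=
    measure_mono (Set.iUnion₂_subset fun b _ => hsub b)
  rw [h1, Real.volume_closedBall] at h2
  simp only [Real.volume_closedBall, ENNReal.ofReal_mul zero_le_two] at h2
  rw [ENNReal.tsum_mul_left] at h2
  exact (ENNReal.mul_le_mul_iff_right (by simp) (by simp)).1 h2

theorem dn_marking {P : Type*} [PartialOrder P] (rk : P → ℕ) (hrk : StrictMono rk) (k : ℕ) :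
    ∃ C : ENNReal, C ≠ ⊤ ∧ ∀ (f : P → ℝ → ℝ), (∀ s, Continuous (f s)) → ∀ (ε ρ : ℝ) (η : ENNReal),
      (∀ s z r, 0 < r → (∃ x ∈ Metric.closedBall z r, ρ ≤ f s x) →
        volume {x | x ∈ Metric.closedBall z r ∧ f s x < ε} ≤ η * ENNReal.ofReal r) →
      (∀ x, {s | f s x < ρ}.Finite) →
      ∀ (R : Finset ℕ), R.card = k → ∀ S : Set P, (∀ s ∈ S, rk s ∈ R) → ∀ z r, 0 < r →
        (∀ s ∈ S, ∃ x ∈ Metric.closedBall z r, ρ ≤ f s x) →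
        volume {x | x ∈ Metric.closedBall z r ∧ ¬ DnMarked f ε ρ S x} ≤
          C * η * ENNReal.ofReal r := by
  induction k with
  | zero =>
    refine ⟨0, by simp, ?_⟩
    intro f hf ε ρ η h1 h2 R hR S hS z r hr hx
    have : {x | x ∈ Metric.closedBall z r ∧ ¬ DnMarked f ε ρ S x} = ∅ := by
      rw [Set.eq_empty_iff_forall_notMem]
      rintro x ⟨-, hx⟩
      refine hx ⟨∅, by simp, by simp, by simp, fun s hs => ?_⟩
      have := hS s hs
      rw [Finset.card_eq_zero.1 hR] at this
      simp at this
    rw [this]; simp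
  | succ k ih =>
    obtain ⟨C, hC, ih⟩ := ih
    obtain ⟨N, τ, hτ, hN⟩ := HasBesicovitchCovering.no_satelliteConfig (α := ℝ)
    refine ⟨N * (3 * (C + 1)), by finiteness, ?_⟩
    intro f hf ε ρ η h1 h2 R hR S hS z r hr hx
    -- the maximal radius choice
    have key : ∀ x : {x // x ∈ Metric.closedBall z r ∧ ∃ s ∈ S, f s x < ρ}, ∃ s ∈ S,
        f s x < ρ ∧ ∀ s' ∈ S, Metric.infDist (x : ℝ) {y | ρ ≤ f s' y} ≤
          Metric.infDist (x : ℝ) {y | ρ ≤ f s y} := by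
      rintro ⟨x, hxB, s0, hs0, hlt⟩
      have hfin : ({s | f s x < ρ} ∩ S).Finite := (h2 x).subset Set.inter_subset_left
      obtain ⟨s, hs, hmax⟩ := Set.exists_max_image _
        (fun s => Metric.infDist x {y | ρ ≤ f s y}) hfin ⟨s0, hlt, hs0⟩
      refine ⟨s, hs.2, hs.1, fun s' hs' => ?_⟩
      by_cases hlt' : f s' x < ρ
      · exact hmax s' ⟨hlt', hs'⟩
      · have : Metric.infDist x {y | ρ ≤ f s' y} = 0 :=
          Metric.infDist_zero_of_mem (not_lt.1 hlt')
        rw [this]; exact Metric.infDist_nonneg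
    choose σ hσS hσlt hσmax using key
    have hclosed : ∀ s, IsClosed {y | ρ ≤ f s y} := fun s => isClosed_le continuous_const (hf s)
    have hne : ∀ s ∈ S, {y | ρ ≤ f s y}.Nonempty := fun s hs => by
      obtain ⟨y, -, hy⟩ := hx s hs; exact ⟨y, hy⟩
    let rad : {x // x ∈ Metric.closedBall z r ∧ ∃ s ∈ S, f s x < ρ} → ℝ :=
      fun x => Metric.infDist (x : ℝ) {y | ρ ≤ f (σ x) y}
    have hrad_pos : ∀ x, 0 < rad x := fun x => by
      refine ((hclosed _).notMem_iff_infDist_pos (hne _ (hσS x))).1 ?_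
      simpa using hσlt x
    have hrad_le : ∀ x, rad x ≤ 2 * r := fun x => by
      obtain ⟨y, hyB, hy⟩ := hx _ (hσS x)
      refine (Metric.infDist_le_dist_of_mem (s := {y | ρ ≤ f (σ x) y}) hy).trans ?_
      have hb := x.2.1
      rw [Metric.mem_closedBall] at hyB hb
      have := dist_triangle_right (x : ℝ) y z
      linarith
    have hhit : ∀ x : {x // x ∈ Metric.closedBall z r ∧ ∃ s ∈ S, f s x < ρ}, ∀ s ∈ S, ∃ y ∈ Metric.closedBall (x : ℝ) (rad x), ρ ≤ f s y := fun x s hs => by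
      obtain ⟨y, hy, hd⟩ := (hclosed s).exists_infDist_eq_dist (hne s hs) (x : ℝ)
      refine ⟨y, ?_, hy⟩
      rw [Metric.mem_closedBall, dist_comm, ← hd]
      exact hσmax x s hs
    have hle : ∀ x : {x // x ∈ Metric.closedBall z r ∧ ∃ s ∈ S, f s x < ρ}, ∀ y ∈ Metric.closedBall (x : ℝ) (rad x), f (σ x) y ≤ ρ := fun x y hy => by
      have hcl : IsClosed {y | f (σ x) y ≤ ρ} := isClosed_le (hf _) continuous_const
      have hsub : Metric.ball (x : ℝ) (rad x) ⊆ {y | f (σ x) y ≤ ρ} := fun w hw => by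
        by_contra hcon
        have hcon' : ρ ≤ f (σ x) w := (not_le.1 hcon).le
        have := Metric.infDist_le_dist_of_mem (x := (x : ℝ)) (s := {y | ρ ≤ f (σ x) y}) hcon'
        rw [Metric.mem_ball, dist_comm] at hw
        exact absurd hw (not_lt.2 this)
      have := hcl.closure_subset_iff.2 hsub
      rw [closure_ball _ (hrad_pos x).ne'] at this
      exact this hy
    let q : Besicovitch.BallPackage {x // x ∈ Metric.closedBall z r ∧ ∃ s ∈ S, f s x < ρ} ℝ :=
      { c := fun x => x, r := rad, rpos := hrad_pos, r_bound := 2 * r, r_le := hrad_le }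
    obtain ⟨fam, hdisj, hcov⟩ := Besicovitch.exist_disjoint_covering_families hτ hN q
    have hlocal : ∀ x : {x // x ∈ Metric.closedBall z r ∧ ∃ s ∈ S, f s x < ρ}, volume {y | y ∈ Metric.closedBall (x : ℝ) (rad x) ∧ ¬ DnMarked f ε ρ S y} ≤
        ((C + 1) * η) * ENNReal.ofReal (rad x) := fun x => by
      let S' : Set P := {s | s ∈ S ∧ (s < σ x ∨ σ x < s)}
      have hA := ih f hf ε ρ η h1 h2 (R.erase (rk (σ x)))
        (by rw [Finset.card_erase_of_mem (hS _ (hσS x)), hR]; rfl) S'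
        (fun s hs => Finset.mem_erase.2 ⟨by
          rcases hs.2 with h | h
          · exact (hrk h).ne
          · exact (hrk h).ne', hS s hs.1⟩) x (rad x) (hrad_pos x) (fun s hs => hhit x s hs.1)
      have hB := h1 (σ x) x (rad x) (hrad_pos x) (hhit x _ (hσS x))
      have hsub : {y | y ∈ Metric.closedBall (x : ℝ) (rad x) ∧ ¬ DnMarked f ε ρ S y} ⊆
          {y | y ∈ Metric.closedBall (x : ℝ) (rad x) ∧ ¬ DnMarked f ε ρ S' y} ∪
          {y | y ∈ Metric.closedBall (x : ℝ) (rad x) ∧ f (σ x) y < ε} := by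
        rintro y ⟨hy, hnm⟩
        by_contra hcon
        simp only [Set.mem_union, Set.mem_ofPred_eq, not_or, not_and, not_not, not_lt] at hcon
        obtain ⟨F, hFS, hch, hF1, hF2⟩ := hcon.1 hy
        refine hnm ⟨insert (σ x) F, ?_, ?_, ?_, ?_⟩
        · rintro s (rfl | hs)
          · exact hσS x
          · exact (hFS hs).1
        · refine hch.insert fun b hb _ => ?_
          rcases (hFS hb).2 with h | h
          · exact Or.inr h.le
          · exact Or.inl h.le
        · rintro s (rfl | hs)
          · exact ⟨hcon.2 hy, hle x y hy⟩
          · exact hF1 s hs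
        · intro s hs hcomp
          by_cases hsx : s = σ x
          · exact Or.inl (Or.inl hsx)
          · have hsS' : s ∈ S' := by
              refine ⟨hs, ?_⟩
              rcases hcomp (σ x) (Or.inl rfl) with h | h
              · exact Or.inl (lt_of_le_of_ne h hsx)
              · exact Or.inr (lt_of_le_of_ne h (Ne.symm hsx))
            rcases hF2 s hsS' (fun t ht => hcomp t (Or.inr ht)) with h | h
            · exact Or.inl (Or.inr h)
            · exact Or.inr h
      calc _ ≤ _ := measure_mono hsub
        _ ≤ _ := measure_union_le _ _
        _ ≤ C * η * ENNReal.ofReal (rad x) + η * ENNReal.ofReal (rad x) := add_le_add hA hB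
        _ = _ := by ring
    have hfam : ∀ i, volume (⋃ j ∈ fam i, {y | y ∈ Metric.closedBall (j : ℝ) (rad j) ∧
        ¬ DnMarked f ε ρ S y}) ≤ ((C + 1) * η) * ENNReal.ofReal (3 * r) := fun i => by
      obtain ⟨hct, hsum⟩ := dn_sum_balls (fam i) (fun x => (x : ℝ)) rad hrad_pos (hdisj i) z (3 * r)
        (fun b => Metric.closedBall_subset_closedBall' (by
          have := hrad_le b
          have h3 := b.2.1
          rw [Metric.mem_closedBall] at h3
          linarith))
      calc _ ≤ _ := measure_biUnion_le _ hct _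
        _ ≤ ∑' j : fam i, ((C + 1) * η) * ENNReal.ofReal (rad j) :=
          ENNReal.tsum_le_tsum fun j => hlocal j
        _ = ((C + 1) * η) * ∑' j : fam i, ENNReal.ofReal (rad j) := ENNReal.tsum_mul_left
        _ ≤ _ := by gcongr
    have hsub : {x | x ∈ Metric.closedBall z r ∧ ¬ DnMarked f ε ρ S x} ⊆
        ⋃ i, ⋃ j ∈ fam i, {y | y ∈ Metric.closedBall (j : ℝ) (rad j) ∧
        ¬ DnMarked f ε ρ S y} := by
      rintro x ⟨hxB, hnm⟩
      have hE : ∃ s ∈ S, f s x < ρ := by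
        by_contra hcon
        push Not at hcon
        exact hnm ⟨∅, by simp, by simp, by simp, fun s hs _ => Or.inr (hcon s hs)⟩
      have := hcov (Set.mem_range_self (⟨x, hxB, hE⟩ :
        {x // x ∈ Metric.closedBall z r ∧ ∃ s ∈ S, f s x < ρ}))
      simp only [Set.mem_iUnion] at this ⊢
      obtain ⟨i, j, hj, hxj⟩ := this
      exact ⟨i, j, hj, Metric.ball_subset_closedBall hxj, hnm⟩
    calc _ ≤ _ := measure_mono hsub
      _ ≤ _ := measure_iUnion_fintype_le _ _
      _ ≤ ∑ i : Fin N, ((C + 1) * η) * ENNReal.ofReal (3 * r) := Finset.sum_le_sum fun i _ => hfam i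
      _ = _ := by
        rw [Finset.sum_const, ENNReal.ofReal_mul (by norm_num)]
        simp
        ring


lemma dn_gram_change {ι L E : Type*} [Fintype ι] [DecidableEq ι] [AddCommGroup L] [Module ℤ L]
    [NormedAddCommGroup E] [InnerProductSpace ℝ E] (b : Module.Basis ι ℤ L) (φ : L →ₗ[ℤ] E)
    (c : ι → L) :
    (gram ℝ (fun i => φ (c i))).det = (((b.toMatrix c).det : ℤ) : ℝ) ^ 2 *
      (gram ℝ (fun i => φ (b i))).det := by
  set A : Matrix ι ι ℝ := (b.toMatrix c).map (Int.castRingHom ℝ) with hA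
  have hdet : A.det = (((b.toMatrix c).det : ℤ) : ℝ) := by
    rw [hA, ← RingHom.mapMatrix_apply, ← RingHom.map_det]; rfl
  have hc : ∀ j, φ (c j) = ∑ i, A i j • φ (b i) := fun j => by
    conv_lhs => rw [← b.sum_repr (c j)]
    rw [map_sum]
    refine Finset.sum_congr rfl fun i _ => ?_
    rw [LinearMap.map_smul, hA]
    exact (Int.cast_smul_eq_zsmul ℝ _ _).symm
  have hG : gram ℝ (fun i => φ (c i)) = Aᵀ * gram ℝ (fun i => φ (b i)) * A := by
    ext i j
    rw [gram_apply, hc, hc, sum_inner]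
    simp only [inner_sum, Matrix.mul_apply, transpose_apply, gram_apply, Finset.sum_mul,
      inner_smul_left, inner_smul_right]
    rw [Finset.sum_comm]
    refine Finset.sum_congr rfl fun x _ => Finset.sum_congr rfl fun y _ => ?_
    simp; ring
  rw [hG, det_mul, det_mul, det_transpose, hdet]; ring

lemma dn_gram_cons_blocks {E : Type*} [NormedAddCommGroup E] [InnerProductSpace ℝ E] {k : ℕ}
    (v : E) (w : Fin k → E) :
    (gram ℝ (Fin.cons v w : Fin (k + 1) → E)).det =
      (fromBlocks (gram ℝ w) (of fun i (_ : Unit) => inner ℝ (w i) v)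
        (of fun (_ : Unit) j => inner ℝ v (w j)) ((‖v‖ ^ 2) • (1 : Matrix Unit Unit ℝ))).det := by
  let e : Fin (k + 1) ≃ Fin k ⊕ Unit := (finSuccEquiv k).trans (Equiv.optionEquivSumPUnit _)
  rw [← det_submatrix_equiv_self e]
  congr 1
  ext i j
  refine Fin.cases ?_ (fun i => ?_) i <;> refine Fin.cases ?_ (fun j => ?_) j <;>
    simp [e, gram_apply]

lemma dn_gram_cons {E : Type*} [NormedAddCommGroup E] [InnerProductSpace ℝ E] {k : ℕ}
    (v : E) (hv : v ≠ 0) (w : Fin k → E) :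
    (gram ℝ (Fin.cons v w : Fin (k + 1) → E)).det =
      ‖v‖ ^ 2 * (gram ℝ (fun i => w i - (inner ℝ v (w i) / ‖v‖ ^ 2) • v)).det := by
  have hv' : ‖v‖ ^ 2 ≠ 0 := by simpa using hv
  rw [dn_gram_cons_blocks]
  let _ : Invertible ((‖v‖ ^ 2) • (1 : Matrix Unit Unit ℝ)) :=
    ⟨(‖v‖ ^ 2)⁻¹ • 1, by simp [smul_smul, hv], by simp [smul_smul, hv]⟩
  rw [det_fromBlocks₂₂]
  have h1 : ⅟((‖v‖ ^ 2) • (1 : Matrix Unit Unit ℝ)) = (‖v‖ ^ 2)⁻¹ • 1 := rfl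
  rw [h1]
  congr 1
  · simp
  · congr 1
    ext i j
    simp only [Matrix.sub_apply, gram_apply, Matrix.mul_apply, Finset.univ_unique, Finset.sum_singleton,
      of_apply, Matrix.smul_apply, Matrix.one_apply, inner_sub_left, inner_sub_right, inner_smul_left,
      inner_smul_right, real_inner_self_eq_norm_sq]
    rw [real_inner_comm v (w i)]
    simp
    field_simp
    ring

lemma dn_fischer {E : Type*} [NormedAddCommGroup E] [InnerProductSpace ℝ E] {k : ℕ}
    (v : E) (w : Fin k → E) (hw : 0 < (gram ℝ w).det) :
    (gram ℝ (Fin.cons v w : Fin (k + 1) → E)).det ≤ (gram ℝ w).det * ‖v‖ ^ 2 := by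
  have hpd : (gram ℝ w).PosDef := (posSemidef_gram ℝ w).posDef_iff_det_ne_zero.mpr hw.ne'
  rw [dn_gram_cons_blocks]
  have : Invertible (gram ℝ w) := invertibleOfIsUnitDet _ (isUnit_iff_ne_zero.2 hw.ne')
  rw [det_fromBlocks₁₁]
  gcongr
  rw [det_unique]
  have := hpd.inv.posSemidef.dotProduct_mulVec_nonneg (fun j => inner ℝ v (w j))
  rw [invOf_eq_nonsing_inv, Matrix.sub_apply, Matrix.mul_assoc, Matrix.mul_apply]
  simp only [Matrix.smul_apply, Matrix.one_apply, of_apply, if_true, smul_eq_mul, mul_one, tsub_le_iff_right,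
    le_add_iff_nonneg_right]
  refine this.trans_eq ?_
  simp [dotProduct, mulVec, Matrix.mul_apply, real_inner_comm v]


lemma dn_exists_functional {ι L : Type*} [Finite ι] [AddCommGroup L]
    (b : Module.Basis ι ℤ L) (x : L)
    (hprim : ∀ (d : ℤ) (y : L), x = d • y → IsUnit d) : ∃ f : L →ₗ[ℤ] ℤ, f x = 1 := by
  let I : Ideal ℤ := LinearMap.range (LinearMap.applyₗ (R := ℤ) (M₂ := ℤ) x)
  obtain ⟨d, hd⟩ := (IsPrincipalIdealRing.principal I).principal
  have hdvd : ∀ i, d ∣ b.repr x i := fun i => by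
    have : b.repr x i ∈ I := ⟨b.coord i, rfl⟩
    rw [hd] at this
    exact Ideal.mem_span_singleton.1 this
  choose g hg using hdvd
  have := Fintype.ofFinite ι
  have hxd : x = d • ∑ i, g i • b i := by
    conv_lhs => rw [← b.sum_repr x]
    rw [Finset.smul_sum]
    refine Finset.sum_congr rfl fun i _ => ?_
    rw [smul_smul, ← hg i]
  have hu := hprim _ _ hxd
  have h1 : (1 : ℤ) ∈ I := by
    rw [hd]
    exact Ideal.mem_span_singleton.2 hu.dvd
  obtain ⟨f, hf⟩ := h1
  exact ⟨f, hf⟩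

lemma dn_near_shortest {L E : Type*} [AddCommGroup L]
    [NormedAddCommGroup E] (φ : L →ₗ[ℤ] E) (m : ℝ) (hm : 0 < m)
    (hmin : ∀ x : L, x ≠ 0 → m ≤ ‖φ x‖) (y : L) (hy : y ≠ 0) :
    ∃ x : L, x ≠ 0 ∧ ∀ y, y ≠ 0 → ‖φ x‖ ≤ 21 / 20 * ‖φ y‖ := by
  let A : Set ℝ := (fun x => ‖φ x‖) '' {x | x ≠ 0}
  have hne : A.Nonempty := ⟨_, y, hy, rfl⟩
  have hbdd : BddBelow A := ⟨m, by rintro _ ⟨x, hx, rfl⟩; exact hmin x hx⟩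
  have hpos : m ≤ sInf A := le_csInf hne (by rintro _ ⟨x, hx, rfl⟩; exact hmin x hx)
  obtain ⟨_, ⟨x, hx, rfl⟩, hlt⟩ := exists_lt_of_csInf_lt hne (show sInf A < 21 / 20 * sInf A by linarith)
  refine ⟨x, hx, fun y hy => hlt.le.trans ?_⟩
  have := csInf_le hbdd (⟨y, hy, rfl⟩ : ‖φ y‖ ∈ A)
  linarith

/-- orthogonal projection away from `v`, as a `ℤ`-linear map -/
noncomputable def dnProj {E : Type*} [NormedAddCommGroup E] [InnerProductSpace ℝ E] (v : E) :
    E →ₗ[ℤ] E where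
  toFun y := y - (inner ℝ v y / ‖v‖ ^ 2) • v
  map_add' a b := by rw [inner_add_right, add_div, add_smul]; abel
  map_smul' c a := by
    rw [← Int.cast_smul_eq_zsmul ℝ, inner_smul_right, mul_div_assoc, mul_smul]
    rw [← Int.cast_smul_eq_zsmul ℝ]
    simp [smul_sub]

lemma dn_proj_norm {E : Type*} [NormedAddCommGroup E] [InnerProductSpace ℝ E] (v w : E) (hv : v ≠ 0) :
    ‖w‖ ^ 2 = ‖w - (inner ℝ v w / ‖v‖ ^ 2) • v‖ ^ 2 + (inner ℝ v w / ‖v‖ ^ 2) ^ 2 * ‖v‖ ^ 2 := by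
  have hv' : ‖v‖ ≠ 0 := by simpa using hv
  rw [norm_sub_sq_real, norm_smul, inner_smul_right, real_inner_comm v w]
  simp only [Real.norm_eq_abs, mul_pow, sq_abs]
  field_simp
  ring

lemma dn_round {E : Type*} [NormedAddCommGroup E] [InnerProductSpace ℝ E] (v w : E) (hv : v ≠ 0) :
    ∃ c : ℤ, ‖w - c • v‖ ^ 2 ≤ ‖dnProj v w‖ ^ 2 + ‖v‖ ^ 2 / 4 := by
  have hv' : ‖v‖ ≠ 0 := by simpa using hv
  set τ := inner ℝ v w / ‖v‖ ^ 2 with hτ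
  refine ⟨round τ, ?_⟩
  rw [← Int.cast_smul_eq_zsmul ℝ]
  have h1 := dn_proj_norm v (w - (round τ : ℝ) • v) hv
  have h2 : inner ℝ v (w - (round τ : ℝ) • v) / ‖v‖ ^ 2 = τ - round τ := by
    rw [inner_sub_right, inner_smul_right, real_inner_self_eq_norm_sq, hτ]
    field_simp
  rw [h2] at h1
  have h3 : w - (round τ : ℝ) • v - (τ - round τ) • v = dnProj v w := by
    change _ = w - τ • v
    rw [sub_smul]; abel
  rw [h3] at h1
  have h4 := abs_sub_round τ
  have h5 : (τ - round τ) ^ 2 ≤ 1 / 4 := by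
    rw [abs_le] at h4; nlinarith [h4.1, h4.2]
  nlinarith [sq_nonneg ‖v‖]

theorem dn_reduction {E : Type*} [NormedAddCommGroup E] [InnerProductSpace ℝ E] (k : ℕ) :
    ∀ m V : ℝ, 0 < m → ∃ C : ℝ, ∀ (L : Type) [AddCommGroup L] [Module ℤ L]
      (b : Module.Basis (Fin k) ℤ L) (φ : L →ₗ[ℤ] E), (∀ x, x ≠ 0 → m ≤ ‖φ x‖) →
      (gram ℝ (fun i => φ (b i))).det ≤ V →
      ∃ b' : Fin k → L, Submodule.span ℤ (Set.range b') = ⊤ ∧ ∀ i, ‖φ (b' i)‖ ≤ C := by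
  induction k with
  | zero =>
    intro m V hm
    refine ⟨0, fun L _ _ b φ _ _ => ⟨b, b.span_eq, fun i => i.elim0⟩⟩
  | succ k ih =>
    intro m V hm
    obtain ⟨C', ih⟩ := ih (m / 2) (V / m ^ 2) (by positivity)
    set D : ℝ := max (2 * C') (Real.sqrt V) with hD
    refine ⟨|C'| + D, fun L _ inst b φ hmin hV => ?_⟩
    obtain rfl : inst = AddCommGroup.toIntModule L := Subsingleton.elim _ _
    obtain ⟨x, hx0, hxmin⟩ := dn_near_shortest φ m hm hmin (b 0) (b.ne_zero 0)
    set v := φ x with hv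
    have hvm : m ≤ ‖v‖ := hmin x hx0
    have hv0 : v ≠ 0 := fun h => by rw [h, norm_zero] at hvm; linarith
    have hvn : 0 < ‖v‖ := by positivity
    obtain ⟨f, hf⟩ := dn_exists_functional b x (fun d y hxy => by
      have hy : y ≠ 0 := by rintro rfl; simp at hxy; exact hx0 hxy
      have h1 := hxmin y hy
      have h2 : ‖v‖ = |(d : ℝ)| * ‖φ y‖ := by
        rw [hv, hxy, LinearMap.map_smul, ← Int.cast_smul_eq_zsmul ℝ, norm_smul, Real.norm_eq_abs]
      have hym := hmin y hy
      have hd0 : d ≠ 0 := by rintro rfl; simp at hxy; exact hx0 hxy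
      by_contra hnu
      have h3 : 2 ≤ |d| := by
        have : |d| ≠ 1 := fun h => hnu (Int.isUnit_iff_abs_eq.2 h)
        have := abs_pos.2 hd0
        omega
      have h4 : (2 : ℝ) ≤ |(d : ℝ)| := by exact_mod_cast h3
      nlinarith)
    let N := LinearMap.ker f
    have : Module.Free ℤ L := Module.Free.of_basis b
    have : Module.Finite ℤ L := Module.Finite.of_basis b
    have hli : ∀ (c : ℤ), ∀ y ∈ N, c • x + y = 0 → c = 0 := fun c y hy h => by
        have := congrArg f h
        rw [map_add, LinearMap.map_smul, hf, LinearMap.mem_ker.1 hy] at this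
        simpa using this
    have hsp : ∀ z : L, ∃ c : ℤ, z + c • x ∈ N :=
      fun z => ⟨-f z, by rw [LinearMap.mem_ker, map_add, LinearMap.map_smul, hf]; simp⟩
    have hfr : Module.finrank ℤ N = k := by
      have h1 := Module.finrank_eq_card_basis
        (Module.Basis.mkFinCons x (Module.finBasis ℤ N) hli hsp)
      have h2 := Module.finrank_eq_card_basis b
      simp at h1 h2
      omega
    let b0 : Module.Basis (Fin k) ℤ N := (Module.finBasis ℤ N).reindex (finCongr hfr)
    let b1 := Module.Basis.mkFinCons x b0 hli hsp
    have hV1 : (gram ℝ (fun i => φ (b1 i))).det ≤ V := by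
      rw [dn_gram_change b φ b1]
      have := b.invertibleToMatrix b1
      rcases Int.isUnit_iff.1 (isUnit_det_of_invertible (b.toMatrix b1)) with h | h <;>
        rw [h] <;> simpa using hV
    have hcons : (fun i => φ (b1 i)) = Fin.cons v (fun i => φ (b0 i)) := by
      ext i
      refine Fin.cases ?_ (fun i => ?_) i <;> simp [b1, hv]
    rw [hcons, dn_gram_cons v hv0] at hV1
    let φ' : N →ₗ[ℤ] E := dnProj v ∘ₗ φ ∘ₗ N.subtype
    have hV2 : (gram ℝ (fun i => φ' (b0 i))).det ≤ V / m ^ 2 := by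
      have h0 : 0 ≤ (gram ℝ (fun i => φ' (b0 i))).det := (posSemidef_gram ℝ _).det_nonneg
      rw [le_div_iff₀ (by positivity)]
      change ‖v‖ ^ 2 * (gram ℝ (fun i => φ' (b0 i))).det ≤ V at hV1
      have : m ^ 2 ≤ ‖v‖ ^ 2 := by gcongr
      nlinarith
    have hmin' : ∀ y : N, y ≠ 0 → ‖v‖ / 2 ≤ ‖φ' y‖ := fun y hy => by
      obtain ⟨c, hc⟩ := dn_round v (φ y) hv0
      have hne : (y : L) - c • x ≠ 0 := fun h => by
        have h1 := congrArg f h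
        rw [map_sub, LinearMap.map_smul, hf, LinearMap.mem_ker.1 y.2] at h1
        have hc0 : c = 0 := by simpa using h1
        rw [hc0] at h
        exact hy (by simpa using h)
      have h2 := hxmin _ hne
      rw [map_sub, LinearMap.map_smul, ← hv] at h2
      change _ ≤ ‖φ' y‖ ^ 2 + _ at hc
      have h3 : ‖v‖ ^ 2 ≤ (21 / 20 * ‖φ y - c • v‖) ^ 2 := by gcongr
      refine le_of_sq_le_sq ?_ (norm_nonneg _)
      nlinarith
    obtain ⟨w, hwspan, hwC⟩ := ih N b0 φ' (fun y hy => by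
      have := hmin' y hy
      linarith) hV2
    have hvD : ‖v‖ ≤ D := by
      by_cases hex : ∃ i, w i ≠ 0
      · obtain ⟨i, hi⟩ := hex
        refine le_trans ?_ (le_max_left _ _)
        linarith [hmin' _ hi, hwC i]
      · push Not at hex
        have hk : k = 0 := by
          by_contra hk
          have : w = 0 := funext hex
          have hbot : Submodule.span ℤ (Set.range w) = ⊥ := by
            rw [Submodule.span_eq_bot]
            rintro _ ⟨i, rfl⟩; exact hex i
          rw [hwspan] at hbot
          have h1 : b0 ⟨0, Nat.pos_of_ne_zero hk⟩ ∈ (⊤ : Submodule ℤ N) := trivial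
          rw [hbot] at h1
          exact b0.ne_zero _ ((Submodule.mem_bot ℤ).1 h1)
        subst hk
        refine le_trans ?_ (le_max_right _ _)
        rw [det_isEmpty, mul_one] at hV1
        exact Real.le_sqrt_of_sq_le hV1
    choose c hc using fun i => dn_round v (φ (w i)) hv0
    refine ⟨Fin.cons x (fun i => (w i : L) - c i • x), ?_, ?_⟩
    · rw [eq_top_iff]
      intro z _
      set W := Submodule.span ℤ (Set.range (Fin.cons x (fun i => (w i : L) - c i • x) : Fin (k + 1) → L))
      have hxW : x ∈ W := Submodule.subset_span ⟨0, rfl⟩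
      have hwW : ∀ i, (w i : L) ∈ W := fun i => by
        have h1 : (w i : L) - c i • x ∈ W := Submodule.subset_span ⟨i.succ, rfl⟩
        have := W.add_mem h1 (W.smul_mem (c i) hxW)
        simpa using this
      have hNW : ∀ y : N, (y : L) ∈ W := fun y => by
        have hy : y ∈ Submodule.span ℤ (Set.range w) := by rw [hwspan]; trivial
        have hle : Submodule.span ℤ (Set.range w) ≤ W.comap N.subtype := by
          rw [Submodule.span_le]
          rintro _ ⟨i, rfl⟩
          exact hwW i
        exact hle hy
      obtain ⟨d, hd⟩ := hsp z
      have := W.sub_mem (hNW ⟨_, hd⟩) (W.smul_mem d hxW)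
      simpa using this
    · intro i
      refine Fin.cases ?_ (fun i => ?_) i
      · simp only [Fin.cons_zero]
        rw [← hv]
        linarith [abs_nonneg C']
      · simp only [Fin.cons_succ]
        rw [map_sub, LinearMap.map_smul, ← hv]
        have h1 := hc i
        change _ ≤ ‖φ' (w i)‖ ^ 2 + _ at h1
        have h2 : ‖φ' (w i)‖ ≤ |C'| := (hwC i).trans (le_abs_self _)
        have hD0 : 0 ≤ D := hvn.le.trans hvD
        refine le_of_sq_le_sq ?_ (by positivity)
        nlinarith [norm_nonneg (φ' (w i)), abs_nonneg C', mul_nonneg (abs_nonneg C') hD0]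


/-- `v ↦ h v` from `ℤ^n` to Euclidean space -/
noncomputable def dnPhi {n : ℕ} (h : Matrix (Fin n) (Fin n) ℝ) :
    (Fin n → ℤ) →ₗ[ℤ] EuclideanSpace ℝ (Fin n) where
  toFun v := WithLp.toLp 2 (h *ᵥ (fun i => (v i : ℝ)))
  map_add' a b := by
    ext i; simp [mulVec, dotProduct, mul_add, Finset.sum_add_distrib]
  map_smul' c a := by
    ext i; simp [mulVec, dotProduct, Finset.mul_sum, mul_left_comm]

lemma dnPhi_apply {n : ℕ} (h : Matrix (Fin n) (Fin n) ℝ) (v : Fin n → ℤ) (i : Fin n) :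
    dnPhi h v i = (h *ᵥ (fun i => (v i : ℝ))) i := rfl

/-- cast to rational vectors -/
def dnQ (n : ℕ) : (Fin n → ℤ) →ₗ[ℤ] (Fin n → ℚ) where
  toFun v := fun i => (v i : ℚ)
  map_add' a b := by ext i; simp
  map_smul' c a := by ext i; simp

lemma dnQ_inj (n : ℕ) : Function.Injective (dnQ n) := fun a b h => by
  ext i
  have := congrFun h i
  exact Int.cast_injective (α := ℚ) this

/-- the integer points of a rational subspace -/
def dnLat {n : ℕ} (W : Submodule ℚ (Fin n → ℚ)) : Submodule ℤ (Fin n → ℤ) :=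
  (W.restrictScalars ℤ).comap (dnQ n)

lemma dn_mem_lat {n : ℕ} (W : Submodule ℚ (Fin n → ℚ)) (v : Fin n → ℤ) :
    v ∈ dnLat W ↔ dnQ n v ∈ W := Iff.rfl

lemma dn_span_lat {n : ℕ} (W : Submodule ℚ (Fin n → ℚ)) {ι : Type*} (b : ι → dnLat W)
    (hb : Submodule.span ℤ (Set.range b) = ⊤) :
    Submodule.span ℚ (Set.range fun i => dnQ n (b i)) = W := by
  apply le_antisymm
  · rw [Submodule.span_le]
    rintro _ ⟨i, rfl⟩
    exact (b i).2
  · intro w hw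
    obtain ⟨⟨N, hN⟩, hint⟩ := IsLocalization.exist_integer_multiples_of_finite
      (nonZeroDivisors ℤ) w
    have hN0 : N ≠ 0 := nonZeroDivisors.ne_zero hN
    choose v hv using hint
    have hvw : dnQ n v = (N : ℚ) • w := by
      ext i
      have := hv i
      simp only [algebraMap_int_eq, eq_intCast] at this
      change (v i : ℚ) = _
      rw [this]
      simp
    have hvL : v ∈ dnLat W := by
      rw [dn_mem_lat, hvw]; exact W.smul_mem _ hw
    have h1 : (⟨v, hvL⟩ : dnLat W) ∈ Submodule.span ℤ (Set.range b) := by rw [hb]; trivial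
    have hle : Submodule.span ℤ (Set.range b) ≤
        ((Submodule.span ℚ (Set.range fun i => dnQ n (b i))).restrictScalars ℤ).comap
          (dnQ n ∘ₗ (dnLat W).subtype) := by
      rw [Submodule.span_le]
      rintro _ ⟨i, rfl⟩
      exact Submodule.subset_span ⟨i, rfl⟩
    have h2 : dnQ n v ∈ Submodule.span ℚ (Set.range fun i => dnQ n (b i)) := hle h1
    rw [hvw] at h2
    have h3 := Submodule.smul_mem _ ((N : ℚ)⁻¹) h2
    rwa [smul_smul, inv_mul_cancel₀ (by exact_mod_cast hN0), one_smul] at h3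

lemma dn_li_Q {n : ℕ} {ι : Type*} (b : ι → (Fin n → ℤ)) :
    LinearIndependent ℤ b ↔ LinearIndependent ℚ (fun i => dnQ n (b i)) := by
  rw [← LinearIndependent.iff_fractionRing ℤ ℚ]
  exact ((dnQ n).linearIndependent_iff_of_injOn (dnQ_inj n).injOn).symm

lemma dn_finrank_lat {n : ℕ} (W : Submodule ℚ (Fin n → ℚ)) :
    Module.finrank ℤ (dnLat W) = Module.finrank ℚ W := by
  let b := Module.finBasis ℤ (dnLat W)
  have h1 := dn_span_lat W b b.span_eq
  have h2 : LinearIndependent ℚ (fun i => dnQ n (b i)) :=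
    (dn_li_Q _).1 (b.linearIndependent.map' (dnLat W).subtype (Submodule.ker_subtype _))
  have h3 := finrank_span_eq_card h2
  rw [h1] at h3
  simpa using h3.symm

/-- a lattice basis -/
noncomputable def dnBasis {n : ℕ} (W : Submodule ℚ (Fin n → ℚ)) :
    Module.Basis (Fin (Module.finrank ℚ W)) ℤ (dnLat W) :=
  (Module.finBasis ℤ (dnLat W)).reindex (finCongr (dn_finrank_lat W))

/-- squared covolume of `h (W ∩ ℤ^n)` -/
noncomputable def dnPsi {n : ℕ} (h : Matrix (Fin n) (Fin n) ℝ) (W : Submodule ℚ (Fin n → ℚ)) : ℝ :=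
  (gram ℝ (fun i => dnPhi h (dnBasis W i))).det

lemma dn_det_ne {n : ℕ} {ι : Type*} [Fintype ι] [DecidableEq ι] (h : Matrix (Fin n) (Fin n) ℝ)
    (hh : h.det ≠ 0) (b : ι → (Fin n → ℤ)) (hb : LinearIndependent ℤ b) :
    0 < (gram ℝ (fun i => dnPhi h (b i))).det := by
  refine lt_of_le_of_ne (posSemidef_gram ℝ _).det_nonneg (Ne.symm ?_)
  rw [det_gram_ne_zero_iff_linearIndependent]
  let B : Matrix ι (Fin n) ℤ := of b
  have hB : (B * Bᵀ).det ≠ 0 := by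
    intro h0
    obtain ⟨v, hv, hv0⟩ := exists_vecMul_eq_zero_iff.2 h0
    have h1 : (v ᵥ* B) ⬝ᵥ (v ᵥ* B) = 0 := by
      rw [← dotProduct_mulVec]
      have : B *ᵥ (v ᵥ* B) = 0 := by
        rw [← hv0, ← vecMul_vecMul, vecMul_transpose]
      rw [this, dotProduct_zero]
    have h2 := dotProduct_self_eq_zero.1 h1
    apply hv
    have h3 := Fintype.linearIndependent_iff.1 hb v (by
      rw [← h2, vecMul_eq_sum]; rfl)
    exact funext h3
  have hB' : (B.map (Int.cast : ℤ → ℝ) * (B.map (Int.cast : ℤ → ℝ))ᵀ).det ≠ 0 := by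
    have := (Int.castRingHom ℝ).map_det (B * Bᵀ)
    rw [RingHom.mapMatrix_apply, Matrix.map_mul] at this
    change _ = (B.map (Int.cast : ℤ → ℝ) * (B.map (Int.cast : ℤ → ℝ))ᵀ).det at this
    rw [← this]
    simpa using hB
  rw [Fintype.linearIndependent_iff]
  intro c hc
  have h4 : h *ᵥ (c ᵥ* B.map (Int.cast : ℤ → ℝ)) = 0 := by
    have h5 : (∑ i, c i • dnPhi h (b i)) =
        WithLp.toLp 2 (h *ᵥ (c ᵥ* B.map (Int.cast : ℤ → ℝ))) := by
      ext j
      rw [vecMul_eq_sum, mulVec_sum]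
      simp only [WithLp.ofLp_sum, Finset.sum_apply, WithLp.ofLp_smul, mulVec_smul]
      rfl
    rw [hc] at h5
    have := congrArg WithLp.ofLp h5
    simpa using this.symm
  have h6 := Matrix.eq_zero_of_mulVec_eq_zero hh h4
  have h7 : c ᵥ* (B.map (Int.cast : ℤ → ℝ) * (B.map (Int.cast : ℤ → ℝ))ᵀ) = 0 := by
    rw [← vecMul_vecMul, h6, zero_vecMul]
  exact congrFun (Matrix.eq_zero_of_vecMul_eq_zero hB' h7)

lemma dnPsi_pos {n : ℕ} (h : Matrix (Fin n) (Fin n) ℝ) (hh : h.det ≠ 0)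
    (W : Submodule ℚ (Fin n → ℚ)) : 0 < dnPsi h W :=
  dn_det_ne h hh _ ((dnBasis W).linearIndependent.map' (dnLat W).subtype (Submodule.ker_subtype _))
lemma dn_psi_sup {n : ℕ} (h : Matrix (Fin n) (Fin n) ℝ) (hh : h.det ≠ 0)
    (W : Submodule ℚ (Fin n → ℚ)) (v : Fin n → ℤ) (hv : dnQ n v ∉ W) :
    dnPsi h (W ⊔ Submodule.span ℚ {dnQ n v}) ≤ dnPsi h W * ‖dnPhi h v‖ ^ 2 := by
  set W' := W ⊔ Submodule.span ℚ {dnQ n v} with hW'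
  have hle : W ≤ W' := le_sup_left
  have hvW' : dnQ n v ∈ W' := (le_sup_right : _ ≤ W') (Submodule.mem_span_singleton_self _)
  have hrk : Module.finrank ℚ W' = Module.finrank ℚ W + 1 := Submodule.finrank_sup_span_singleton hv
  let b := (dnBasis W').reindex (finCongr hrk)
  let φ : dnLat W' →ₗ[ℤ] EuclideanSpace ℝ (Fin n) := dnPhi h ∘ₗ (dnLat W').subtype
  let w : Fin (Module.finrank ℚ W) → dnLat W' := fun i => ⟨dnBasis W i, hle (dnBasis W i).2⟩
  let c : Fin (Module.finrank ℚ W + 1) → dnLat W' := Fin.cons ⟨v, hvW'⟩ w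
  have hpsi : dnPsi h W' = (gram ℝ (fun i => φ (b i))).det := by
    have : gram ℝ (fun i => φ (b i)) =
        (gram ℝ (fun i => dnPhi h (dnBasis W' i))).submatrix (finCongr hrk).symm (finCongr hrk).symm := by
      ext i j; simp [gram, b, φ]
    rw [this, det_submatrix_equiv_self]; rfl
  have hcons : (fun i => φ (c i)) =
      (Fin.cons (dnPhi h v) (fun i => dnPhi h (dnBasis W i)) : Fin (Module.finrank ℚ W + 1) → _) := by
    funext i
    refine Fin.cases ?_ (fun j => ?_) i
    · simp [c, φ]
    · simp [c, φ, w]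
  have hcli : LinearIndependent ℤ c := by
    have h1 : LinearIndependent ℤ (fun i => ((c i : dnLat W') : Fin n → ℤ)) := by
      rw [dn_li_Q]
      have : (fun i => dnQ n ((c i : dnLat W') : Fin n → ℤ)) =
        (Fin.cons (dnQ n v) (fun i => dnQ n (dnBasis W i)) : Fin (Module.finrank ℚ W + 1) → _) := by
        funext i
        refine Fin.cases ?_ (fun j => ?_) i
        · simp [c]
        · simp [c, w]
      rw [this]
      refine LinearIndependent.finCons ((dn_li_Q _).1 ((dnBasis W).linearIndependent.map'
        (dnLat W).subtype (Submodule.ker_subtype _))) ?_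
      rw [dn_span_lat W (dnBasis W) (dnBasis W).span_eq]
      exact hv
    exact LinearIndependent.of_comp (dnLat W').subtype h1
  have hg := dn_gram_change b φ c
  have hpos : 0 < (gram ℝ (fun i => φ (c i))).det :=
    dn_det_ne h hh (fun i => ((c i : dnLat W') : Fin n → ℤ))
      (hcli.map' (dnLat W').subtype (Submodule.ker_subtype _))
  rw [← hpsi] at hg
  have hP := dnPsi_pos h hh W'
  have hd : (b.toMatrix c).det ≠ 0 := by
    intro h0
    rw [hg, h0] at hpos
    simp at hpos
  have hd2 : (1 : ℝ) ≤ (((b.toMatrix c).det : ℤ) : ℝ) ^ 2 := by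
    have : 1 ≤ |(b.toMatrix c).det| := Int.one_le_abs hd
    rw [← sq_abs, ← Int.cast_abs]
    have h2 : (1 : ℝ) ≤ ((|(b.toMatrix c).det| : ℤ) : ℝ) := by exact_mod_cast this
    nlinarith
  have hf := dn_fischer (dnPhi h v) (fun i => dnPhi h (dnBasis W i)) (dnPsi_pos h hh W)
  rw [← hcons, hg] at hf
  change _ ≤ dnPsi h W * _ at hf
  nlinarith

lemma dn_psi_bot {n : ℕ} (h : Matrix (Fin n) (Fin n) ℝ) :
    dnPsi h (⊥ : Submodule ℚ (Fin n → ℚ)) = 1 := by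
  have : IsEmpty (Fin (Module.finrank ℚ (⊥ : Submodule ℚ (Fin n → ℚ)))) := by
    rw [finrank_bot]; infer_instance
  exact det_isEmpty

lemma dn_exists_bound {n : ℕ} (h : Matrix (Fin n) (Fin n) ℝ) (hh : h.det ≠ 0) :
    ∃ M : ℝ, 0 < M ∧ ∀ (v : Fin n → ℤ) i, |(v i : ℝ)| ≤ M * ‖dnPhi h v‖ := by
  refine ⟨1 + ∑ i, ∑ j, |h⁻¹ i j|, by positivity, fun v i => ?_⟩
  have hv : (fun i => (v i : ℝ)) = h⁻¹ *ᵥ (h *ᵥ (fun i => (v i : ℝ))) := by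
    rw [mulVec_mulVec, nonsing_inv_mul _ (Ne.isUnit hh), one_mulVec]
  have h1 : (v i : ℝ) = ∑ j, h⁻¹ i j * dnPhi h v j := congrFun hv i
  rw [h1]
  calc |∑ j, h⁻¹ i j * dnPhi h v j| ≤ ∑ j, |h⁻¹ i j * dnPhi h v j| := Finset.abs_sum_le_sum_abs _ _
    _ ≤ ∑ j, |h⁻¹ i j| * ‖dnPhi h v‖ := by
        refine Finset.sum_le_sum fun j _ => ?_
        rw [abs_mul]
        exact mul_le_mul_of_nonneg_left (PiLp.norm_apply_le (dnPhi h v) j) (abs_nonneg _)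
    _ = (∑ j, |h⁻¹ i j|) * ‖dnPhi h v‖ := by rw [Finset.sum_mul]
    _ ≤ _ := by
        refine mul_le_mul_of_nonneg_right ?_ (norm_nonneg _)
        have := Finset.single_le_sum (f := fun i => ∑ j, |h⁻¹ i j|)
          (fun i _ => Finset.sum_nonneg fun j _ => abs_nonneg _) (Finset.mem_univ i)
        change ∑ j, |h⁻¹ i j| ≤ _ at this
        linarith

lemma dn_psi_finite {n : ℕ} (h : Matrix (Fin n) (Fin n) ℝ) (hh : h.det ≠ 0) (ρ : ℝ) :
    {W : Submodule ℚ (Fin n → ℚ) | dnPsi h W < ρ}.Finite := by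
  obtain ⟨M, hM, hb⟩ := dn_exists_bound h hh
  have key : ∀ k : ℕ, {W : Submodule ℚ (Fin n → ℚ) | dnPsi h W < ρ ∧ Module.finrank ℚ W = k}.Finite := by
    intro k
    obtain ⟨C, hC⟩ := dn_reduction (E := EuclideanSpace ℝ (Fin n)) k (1 / M) ρ (by positivity)
    let N : ℤ := ⌈M * C⌉
    have hfin : (Set.Icc (fun (_ : Fin k) (_ : Fin n) => -N) (fun _ _ => N)).Finite := Set.finite_Icc _ _
    refine (hfin.image (fun b => Submodule.span ℚ (Set.range fun i => dnQ n (b i)))).subset ?_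
    rintro W ⟨hW, rfl⟩
    obtain ⟨b', hs, hn⟩ := hC (dnLat W) (dnBasis W) (dnPhi h ∘ₗ (dnLat W).subtype) (by
      intro x hx
      have hx' : (x : Fin n → ℤ) ≠ 0 := by simpa using hx
      obtain ⟨i, hi⟩ := Function.ne_iff.1 hx'
      have h1 := hb x i
      have h2 : (1 : ℝ) ≤ |((x : Fin n → ℤ) i : ℝ)| := by
        rw [← Int.cast_abs]; exact_mod_cast Int.one_le_abs hi
      rw [div_le_iff₀ hM]
      change _ ≤ ‖dnPhi h x‖ * M
      linarith) hW.le
    refine ⟨fun i => b' i, ?_, dn_span_lat W b' hs⟩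
    have hbd : ∀ i j, |(b' i : Fin n → ℤ) j| ≤ N := by
      intro i j
      have h1 := hb (b' i) j
      have h2 : ‖dnPhi h (b' i)‖ ≤ C := hn i
      have h3 : |(((b' i : Fin n → ℤ) j : ℤ) : ℝ)| ≤ M * C := h1.trans (by gcongr)
      have h4 : ((|(b' i : Fin n → ℤ) j| : ℤ) : ℝ) ≤ (N : ℝ) := by
        rw [Int.cast_abs]; exact h3.trans (Int.le_ceil _)
      exact_mod_cast h4
    exact ⟨fun i j => (abs_le.1 (hbd i j)).1, fun i j => (abs_le.1 (hbd i j)).2⟩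
  refine ((Set.finite_Iic n).biUnion (fun k _ => key k)).subset ?_
  intro W hW
  refine Set.mem_biUnion (x := Module.finrank ℚ W) ?_ ⟨hW, rfl⟩
  have := Submodule.finrank_le W
  simpa using this

lemma dn_marked_bound {n : ℕ} (h : ℝ → Matrix (Fin n) (Fin n) ℝ) (x : ℝ) (hh : (h x).det ≠ 0)
    (ε ρ : ℝ) (hε : ε ≤ ρ) (hρ : ρ ≤ 1)
    (hm : DnMarked (fun (W : Submodule ℚ (Fin n → ℚ)) t => dnPsi (h t) W) ε ρ Set.univ x)
    (v : Fin n → ℤ) (hv : v ≠ 0) : ε ≤ ‖dnPhi (h x) v‖ ^ 2 := by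
  obtain ⟨F, -, hch, hF, hmax⟩ := hm
  have hv' : dnQ n v ≠ 0 := fun h0 => hv (dnQ_inj n (by rw [h0, map_zero]))
  obtain ⟨W0, ⟨hW0F, hW0v⟩, hW0m⟩ := WellFounded.has_min
    (wellFounded_gt (α := Submodule ℚ (Fin n → ℚ))) {W | W ∈ insert ⊥ F ∧ dnQ n v ∉ W}
    ⟨⊥, by simp, by simpa using hv'⟩
  set W' := W0 ⊔ Submodule.span ℚ {dnQ n v} with hW'
  have hvW' : dnQ n v ∈ W' := (le_sup_right : _ ≤ W') (Submodule.mem_span_singleton_self _)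
  have hlow : ∀ t ∈ F, W0 ≤ t ∨ t ≤ W0 := by
    intro t ht
    rcases hW0F with h1 | h1
    · left; rw [h1]; exact bot_le
    · rcases hch.total h1 ht with h | h
      · exact Or.inl h
      · exact Or.inr h
  have hcomp : ∀ t ∈ F, W' ≤ t ∨ t ≤ W' := by
    intro t ht
    by_cases hvt : dnQ n v ∈ t
    · left
      refine sup_le ?_ (by simpa using hvt)
      rcases hlow t ht with h | h
      · exact h
      · exact absurd (h hvt) hW0v
    · right
      have h1 := hW0m t ⟨Set.mem_insert_of_mem _ ht, hvt⟩
      rcases hlow t ht with h | h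
      · have : ¬ W0 < t := h1
        have : W0 = t := by_contra fun hne => this (lt_of_le_of_ne h hne)
        rw [← this]; exact le_sup_left
      · exact h.trans le_sup_left
  have hlb : ε ≤ dnPsi (h x) W' := by
    rcases hmax W' trivial hcomp with h1 | h1
    · exact (hF W' h1).1
    · exact hε.trans h1
  have hub : dnPsi (h x) W0 ≤ 1 := by
    rcases hW0F with h1 | h1
    · rw [h1, dn_psi_bot]
    · exact (hF W0 h1).2.trans hρ
  have := dn_psi_sup (h x) hh W0 v hW0v
  nlinarith [sq_nonneg ‖dnPhi (h x) v‖]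

lemma dn_mahler (n : ℕ) (m : ℝ) (hm : 0 < m) :
    ∃ K : Set (SL(n, ℝ) ⧸ SLZ n), IsCompact K ∧ ∀ h : SL(n, ℝ),
      (∀ v : Fin n → ℤ, v ≠ 0 → m ≤ ‖dnPhi (h : Matrix (Fin n) (Fin n) ℝ) v‖) →
        (h : SL(n, ℝ) ⧸ SLZ n) ∈ K := by
  obtain ⟨C, hC⟩ := dn_reduction (E := EuclideanSpace ℝ (Fin n)) n m 1 hm
  let B : Set (Matrix (Fin n) (Fin n) ℝ) :=
    Set.pi Set.univ (fun _ => Set.pi Set.univ fun _ => Set.Icc (-C) C)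
  have hB : IsCompact B :=
    isCompact_univ_pi fun _ => isCompact_univ_pi fun _ => isCompact_Icc
  have hcl : IsClosed {A : Matrix (Fin n) (Fin n) ℝ | A.det = 1} :=
    isClosed_eq (continuous_id.matrix_det) continuous_const
  have hemb : Topology.IsClosedEmbedding
      (Subtype.val : {A : Matrix (Fin n) (Fin n) ℝ // A.det = 1} → Matrix (Fin n) (Fin n) ℝ) :=
    hcl.isClosedEmbedding_subtypeVal
  have hK0 : IsCompact {g : SL(n, ℝ) | (g : Matrix (Fin n) (Fin n) ℝ) ∈ B} :=
    hemb.isCompact_preimage hB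
  refine ⟨_, hK0.image (f := fun g : SL(n, ℝ) => (g : SL(n, ℝ) ⧸ SLZ n)) continuous_quot_mk, ?_⟩
  intro h hh
  have hcol : ∀ i j, dnPhi (h : Matrix (Fin n) (Fin n) ℝ) (Pi.basisFun ℤ (Fin n) i) j = h j i := by
    intro i j
    rw [dnPhi_apply, Pi.basisFun_apply]
    simp [mulVec, dotProduct, Pi.single_apply]
  have hgram : (gram ℝ fun i => dnPhi (h : Matrix (Fin n) (Fin n) ℝ) (Pi.basisFun ℤ (Fin n) i)).det = 1 := by
    have : (gram ℝ fun i => dnPhi (h : Matrix (Fin n) (Fin n) ℝ) (Pi.basisFun ℤ (Fin n) i)) =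
        (h : Matrix (Fin n) (Fin n) ℝ)ᵀ * (h : Matrix (Fin n) (Fin n) ℝ) := by
      ext i j
      rw [gram_apply, PiLp.inner_apply, Matrix.mul_apply]
      simp only [hcol, transpose_apply]
      simp [mul_comm]
    rw [this, det_mul, det_transpose, h.2, one_mul]
  obtain ⟨b', hs, hn⟩ := hC (Fin n → ℤ) (Pi.basisFun ℤ (Fin n)) (dnPhi h) hh hgram.le
  have hγ : ∃ γ : Matrix (Fin n) (Fin n) ℤ, γ.det = 1 ∧ ∀ j, ‖dnPhi (h : Matrix (Fin n) (Fin n) ℝ) (γ.col j)‖ ≤ C := by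
    let γ : Matrix (Fin n) (Fin n) ℤ := of fun i j => b' j i
    have hc : ∀ j, γ.col j = b' j := fun j => rfl
    have hsur : Function.Surjective γ.mulVec := by
      have := range_mulVecLin γ
      have h2 : γ.col = b' := rfl
      rw [h2, hs, LinearMap.range_eq_top] at this
      exact this
    obtain ⟨δ, hδ⟩ := mulVec_surjective_iff_exists_right_inverse.1 hsur
    have hu : IsUnit γ.det := by
      refine IsUnit.of_mul_eq_one δ.det ?_
      rw [← det_mul, hδ, det_one]
    rcases Int.isUnit_iff.1 hu with h1 | h1
    · exact ⟨γ, h1, hn⟩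
    · rcases isEmpty_or_nonempty (Fin n) with he | ⟨⟨i0⟩⟩
      · rw [det_isEmpty] at h1; omega
      · refine ⟨γ.updateCol i0 ((-1 : ℤ) • γ.col i0), ?_, fun j => ?_⟩
        · rw [det_updateCol_smul]
          have : γ.updateCol i0 (γ.col i0) = γ := updateCol_eq_self γ i0
          rw [this, h1]; rfl
        · by_cases hj : j = i0
          · subst hj
            have : (γ.updateCol j ((-1 : ℤ) • γ.col j)).col j = - γ.col j := by
              ext i; simp [Matrix.col]
            rw [this, map_neg, norm_neg]; exact hn j
          · have : (γ.updateCol i0 ((-1 : ℤ) • γ.col i0)).col j = γ.col j := by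
              ext i; simp [Matrix.col, updateCol_ne hj]
            rw [this]; exact hn j
  obtain ⟨γ, hγ1, hγn⟩ := hγ
  let γ' : SL(n, ℤ) := ⟨γ, hγ1⟩
  let γR : SL(n, ℝ) := Matrix.SpecialLinearGroup.map (n := Fin n) (Int.castRingHom ℝ) γ'
  refine ⟨h * γR, ?_, ?_⟩
  · have : ∀ i j, |((h * γR : SL(n, ℝ)) : Matrix (Fin n) (Fin n) ℝ) i j| ≤ C := by
      intro i j
      refine le_trans ?_ (hγn j)
      exact PiLp.norm_apply_le (dnPhi (h : Matrix (Fin n) (Fin n) ℝ) (γ.col j)) i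
    exact fun i _ j _ => abs_le.1 (this i j)
  · refine (QuotientGroup.eq.2 ?_)
    have : (h * γR)⁻¹ * h = γR⁻¹ := by group
    rw [this]
    exact (SLZ n).inv_mem ⟨γ', rfl⟩

lemma dn_pow_poly {n : ℕ} (A : Matrix (Fin n) (Fin n) ℝ) (hA : IsNilpotent (A - 1)) :
    ∃ Q : Fin n → Fin n → Polynomial ℝ, ∀ (m : ℕ) i j, (A ^ m) i j = (Q i j).eval (m : ℝ) := by
  obtain ⟨k, hk⟩ := hA
  set N := A - 1 with hN
  refine ⟨fun i j => ∑ l ∈ Finset.range k,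
    Polynomial.C ((N ^ l) i j / (l.factorial : ℝ)) * descPochhammer ℝ l, fun m i j => ?_⟩
  have hA' : A = N + 1 := by rw [hN]; abel
  have h1 : A ^ m = ∑ l ∈ Finset.range k, (m.choose l : ℝ) • N ^ l := by
    rw [hA', (Commute.one_right N).add_pow]
    simp only [one_pow, mul_one]
    have e1 : ∑ l ∈ Finset.range (m + 1), N ^ l * (m.choose l : Matrix (Fin n) (Fin n) ℝ) =
        ∑ l ∈ Finset.range (m + 1 + k), (m.choose l : ℝ) • N ^ l := by
      rw [Finset.sum_range_add _ (m + 1) k]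
      rw [Finset.sum_eq_zero (s := Finset.range k), add_zero]
      · refine Finset.sum_congr rfl fun l _ => ?_
        rw [← nsmul_eq_mul', Nat.cast_smul_eq_nsmul]
      · intro l _
        rw [Nat.choose_eq_zero_of_lt (by omega)]; simp
    rw [e1, show m + 1 + k = k + (m + 1) by omega, Finset.sum_range_add _ k (m + 1)]
    rw [Finset.sum_eq_zero (s := Finset.range (m + 1)), add_zero]
    intro l _
    rw [pow_add, hk, zero_mul, smul_zero]
  rw [h1, Polynomial.eval_finsetSum, Matrix.sum_apply]
  refine Finset.sum_congr rfl fun l _ => ?_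
  rw [Matrix.smul_apply, Polynomial.eval_mul, Polynomial.eval_C,
    descPochhammer_eval_eq_descFactorial, Nat.descFactorial_eq_factorial_mul_choose]
  have : (l.factorial : ℝ) ≠ 0 := by exact_mod_cast l.factorial_ne_zero
  push_cast
  rw [smul_eq_mul]
  field_simp

lemma dn_poly_ext (p q : Polynomial ℝ) (k : ℝ) (h : ∀ m : ℕ, k ≤ m → p.eval (m : ℝ) = q.eval (m : ℝ)) :
    p = q := by
  refine Polynomial.eq_of_infinite_eval_eq p q ?_
  obtain ⟨K, hK⟩ := exists_nat_ge k
  refine Set.infinite_of_injective_forall_mem (f := fun m : ℕ => ((m + K : ℕ) : ℝ)) ?_ ?_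
  · intro a b hab
    simpa using hab
  · intro m
    refine h _ ?_
    push_cast
    have : (0 : ℝ) ≤ m := m.cast_nonneg
    linarith

lemma dn_unip_poly (n : ℕ) (u : ℝ → SL(n, ℝ))
    (hu_hom : ∀ s t : ℝ, u (s + t) = u s * u t) (hu_cont : Continuous u)
    (hu_unip : ∀ t : ℝ, IsNilpotent ((u t : Matrix (Fin n) (Fin n) ℝ) - 1)) :
    ∃ P : Fin n → Fin n → Polynomial ℝ, ∀ (t : ℝ) i j, u t i j = (P i j).eval t := by
  have h0 : u 0 = 1 := by
    have := hu_hom 0 0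
    rw [add_zero] at this
    exact (left_eq_mul.1 this)
  have hpow : ∀ (m : ℕ) t, u (m * t) = u t ^ m := by
    intro m t
    induction m with
    | zero => simp [h0]
    | succ m ih => rw [pow_succ, ← ih, ← hu_hom]; congr 1; push_cast; ring
  have hpowM : ∀ (m : ℕ) t, (u (m * t) : Matrix (Fin n) (Fin n) ℝ) = (u t : Matrix (Fin n) (Fin n) ℝ) ^ m := by
    intro m t; rw [hpow]; exact Matrix.SpecialLinearGroup.coe_pow _ _
  choose Q hQ using fun t => dn_pow_poly (u t : Matrix (Fin n) (Fin n) ℝ) (hu_unip t)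
  have hQ' : ∀ t (m : ℕ) i j, u (m * t) i j = (Q t i j).eval (m : ℝ) := by
    intro t m i j
    have := hpowM m t
    rw [this]; exact hQ t m i j
  have hrat : ∀ (m q : ℕ), 0 < q → ∀ i j, u (m / q) i j = (Q 1 i j).eval ((m : ℝ) / q) := by
    intro m q hq i j
    have hq' : (q : ℝ) ≠ 0 := by positivity
    have h1 : Q 1 i j = (Q (1 / q) i j).comp (Polynomial.C (q : ℝ) * Polynomial.X) := by
      refine dn_poly_ext _ _ 0 fun m _ => ?_
      rw [← hQ' 1 m, Polynomial.eval_comp]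
      simp only [Polynomial.eval_mul, Polynomial.eval_C, Polynomial.eval_X]
      have := hQ' (1 / q) (q * m) i j
      push_cast at this
      rw [← this, show (q : ℝ) * m * (1 / q) = m * 1 by field_simp]
    rw [h1, Polynomial.eval_comp]
    simp only [Polynomial.eval_mul, Polynomial.eval_C, Polynomial.eval_X]
    rw [mul_div_cancel₀ _ hq', ← hQ', mul_one_div]
  have hcont : ∀ i j, Continuous fun t => u t i j := by
    intro i j
    have h1 : Continuous fun t => (u t : Matrix (Fin n) (Fin n) ℝ) := continuous_subtype_val.comp hu_cont
    exact h1.matrix_elem i j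
  have hnn : ∀ t : ℝ, 0 ≤ t → ∀ i j, u t i j = (Q 1 i j).eval t := by
    intro t ht i j
    have hlim : Tendsto (fun q : ℕ => ((⌊t * q⌋₊ : ℕ) : ℝ) / (q : ℝ)) atTop (nhds t) :=
      (tendsto_nat_floor_mul_div_atTop ht).comp tendsto_natCast_atTop_atTop
    have hl1 := ((hcont i j).tendsto t).comp hlim
    have hl2 := ((Q 1 i j).continuous.tendsto t).comp hlim
    refine tendsto_nhds_unique (hl1.congr' ?_) hl2
    filter_upwards [eventually_gt_atTop 0] with q hq
    exact hrat _ q hq i j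
  refine ⟨Q 1, fun t i j => ?_⟩
  have h2 : (∑ k, Polynomial.C (u t i k) * Q 1 k j) = (Q 1 i j).comp (Polynomial.C t + Polynomial.X) := by
    refine dn_poly_ext _ _ (-t) fun m hm => ?_
    rw [Polynomial.eval_finsetSum, Polynomial.eval_comp]
    simp only [Polynomial.eval_mul, Polynomial.eval_C, Polynomial.eval_X, Polynomial.eval_add]
    rw [← hnn _ (by linarith), hu_hom]
    rw [Matrix.SpecialLinearGroup.coe_mul, Matrix.mul_apply]
    refine Finset.sum_congr rfl fun k _ => ?_
    rw [hnn _ m.cast_nonneg]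
  have h3 := congrArg (Polynomial.eval 0) h2
  rw [Polynomial.eval_finsetSum, Polynomial.eval_comp] at h3
  simp only [Polynomial.eval_mul, Polynomial.eval_C, Polynomial.eval_X, Polynomial.eval_add, add_zero] at h3
  rw [← h3]
  simp only [← hnn 0 le_rfl, h0]
  simp [Matrix.one_apply]

lemma dn_det_natDegree {k : ℕ} (M : Matrix (Fin k) (Fin k) (Polynomial ℝ)) (d : ℕ)
    (hM : ∀ i j, (M i j).natDegree ≤ d) : M.det.natDegree ≤ k * d := by
  rw [det_apply]
  refine Polynomial.natDegree_sum_le_of_forall_le _ _ fun σ _ => ?_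
  refine (Polynomial.natDegree_smul_le _ _).trans ?_
  refine (Polynomial.natDegree_prod_le _ _).trans ?_
  refine (Finset.sum_le_card_nsmul _ _ d fun i _ => hM _ _).trans ?_
  simp

lemma dn_psi_poly {n : ℕ} (P : Fin n → Fin n → Polynomial ℝ) (g : Matrix (Fin n) (Fin n) ℝ)
    (h : ℝ → Matrix (Fin n) (Fin n) ℝ)
    (hh : ∀ t, h t = (of fun i j => (P i j).eval t) * g) :
    ∃ D : ℕ, ∀ W : Submodule ℚ (Fin n → ℚ), ∃ p : Polynomial ℝ, p.natDegree ≤ D ∧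
      ∀ t, dnPsi (h t) W = p.eval t := by
  let D0 := ∑ i, ∑ j, (P i j).natDegree
  have hD0 : ∀ i j, (P i j).natDegree ≤ D0 := fun i j =>
    (Finset.single_le_sum (f := fun j => (P i j).natDegree) (fun _ _ => Nat.zero_le _)
      (Finset.mem_univ j)).trans
    (Finset.single_le_sum (f := fun i => ∑ j, (P i j).natDegree) (fun _ _ => Nat.zero_le _)
      (Finset.mem_univ i))
  let e : (Fin n → ℤ) → Fin n → Polynomial ℝ := fun v i =>
    ∑ k, P i k * Polynomial.C ((g *ᵥ fun i => (v i : ℝ)) k)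
  have he : ∀ v i, (e v i).natDegree ≤ D0 := fun v i =>
    Polynomial.natDegree_sum_le_of_forall_le _ _ fun k _ =>
      (Polynomial.natDegree_mul_C_le _ _).trans (hD0 i k)
  have hev : ∀ v i t, dnPhi (h t) v i = (e v i).eval t := by
    intro v i t
    rw [dnPhi_apply, hh, ← mulVec_mulVec, Polynomial.eval_finsetSum]
    simp only [Polynomial.eval_mul, Polynomial.eval_C]
    rfl
  refine ⟨n * (D0 + D0), fun W => ?_⟩
  let M : Matrix (Fin (Module.finrank ℚ W)) (Fin (Module.finrank ℚ W)) (Polynomial ℝ) :=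
    of fun a b => ∑ i, e (dnBasis W a) i * e (dnBasis W b) i
  refine ⟨M.det, ?_, fun t => ?_⟩
  · refine (dn_det_natDegree M (D0 + D0) fun a b => ?_).trans ?_
    · change (∑ i, e (dnBasis W a) i * e (dnBasis W b) i).natDegree ≤ D0 + D0
      exact Polynomial.natDegree_sum_le_of_forall_le _ _ fun i _ =>
        Polynomial.natDegree_mul_le_of_le (he _ _) (he _ _)
    · refine Nat.mul_le_mul_right _ ?_
      simpa using Submodule.finrank_le W
  · have h1 := (Polynomial.evalRingHom t).map_det M
    rw [Polynomial.coe_evalRingHom] at h1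
    rw [h1, dnPsi]
    congr 1
    ext a b
    rw [gram_apply, PiLp.inner_apply]
    simp only [hev, RingHom.mapMatrix_apply, Matrix.map_apply, M, of_apply,
      Polynomial.coe_evalRingHom, Polynomial.eval_finsetSum, Polynomial.eval_mul]
    refine Finset.sum_congr rfl fun i _ => ?_
    exact mul_comm _ _

/-- **Dani**: nondivergence of unipotent flows.  For every point `a` of
`SL(n,ℝ)/SL(n,ℤ)` and every `ε > 0` there is a compact set `K` such that the fraction
of time `[0,T]` that the unipotent orbit of `a` spends outside `K` is asymptotically
less than `ε`. -/
theorem dani_nondivergence (n : ℕ) (u : ℝ → SL(n, ℝ))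
    (hu_hom : ∀ s t : ℝ, u (s + t) = u s * u t) (hu_cont : Continuous u)
    (hu_unip : ∀ t : ℝ, IsNilpotent ((u t : Matrix (Fin n) (Fin n) ℝ) - 1))
    (a : SL(n, ℝ) ⧸ SLZ n) (ε : ℝ) (hε : 0 < ε) :
    ∃ K : Set (SL(n, ℝ) ⧸ SLZ n), IsCompact K ∧
      Filter.limsup
        (fun T : ℝ => (volume {t : ℝ | t ∈ Set.Icc 0 T ∧ u t • a ∉ K}).toReal / T)
        Filter.atTop < ε := by
  obtain ⟨g, rfl⟩ := QuotientGroup.mk_surjective a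
  obtain ⟨P, hP⟩ := dn_unip_poly n u hu_hom hu_cont hu_unip
  let h : ℝ → Matrix (Fin n) (Fin n) ℝ := fun t => ((u t * g : SL(n, ℝ)) : Matrix (Fin n) (Fin n) ℝ)
  have hdet : ∀ t, (h t).det ≠ 0 := fun t => by
    rw [show (h t).det = 1 from (u t * g).2]; exact one_ne_zero
  have hh : ∀ t, h t = (of fun i j => (P i j).eval t) * (g : Matrix (Fin n) (Fin n) ℝ) := by
    intro t
    have : (of fun i j => (P i j).eval t) = (u t : Matrix (Fin n) (Fin n) ℝ) := by
      ext i j; exact (hP t i j).symm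
    rw [this]; exact Matrix.SpecialLinearGroup.coe_mul _ _
  obtain ⟨D, hD⟩ := dn_psi_poly P g h hh
  let f : Submodule ℚ (Fin n → ℚ) → ℝ → ℝ := fun W t => dnPsi (h t) W
  have hfpos : ∀ W t, 0 < f W t := fun W t => dnPsi_pos (h t) (hdet t) W
  have hfcont : ∀ W, Continuous (f W) := by
    intro W
    obtain ⟨p, -, hp⟩ := hD W
    have : f W = fun t => p.eval t := funext hp
    rw [this]; exact p.continuous
  have hρ : ∃ ρ : ℝ, 0 < ρ ∧ ρ ≤ 1 ∧ ∀ W, ρ ≤ f W 0 := by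
    have hfin := dn_psi_finite (h 0) (hdet 0) 1
    rcases Set.eq_empty_or_nonempty {W : Submodule ℚ (Fin n → ℚ) | dnPsi (h 0) W < 1} with he | hne
    · refine ⟨1, one_pos, le_rfl, fun W => ?_⟩
      by_contra hlt
      have : W ∈ {W : Submodule ℚ (Fin n → ℚ) | dnPsi (h 0) W < 1} := not_le.1 hlt
      rw [he] at this; exact this
    · obtain ⟨W0, hW0, hmin⟩ := hfin.exists_minimalFor (fun W => f W 0) _ hne
      have hW0' : f W0 0 < 1 := hW0
      refine ⟨f W0 0, hfpos _ _, hW0'.le, fun W => ?_⟩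
      by_contra hlt
      have hlt' : f W 0 < f W0 0 := not_le.1 hlt
      have := hmin (j := W) (hlt'.trans hW0') hlt'.le
      exact hlt this
  obtain ⟨ρ, hρ0, hρ1, hρf⟩ := hρ
  obtain ⟨C, hC, hmark⟩ := dn_marking (P := Submodule ℚ (Fin n → ℚ))
    (fun W => Module.finrank ℚ W) (fun _ _ hlt => Submodule.finrank_lt_finrank_of_lt hlt) (n + 1)
  let η : ℝ := ε / (C.toReal + 1)
  have hη : 0 < η := by
    have : 0 ≤ C.toReal := ENNReal.toReal_nonneg
    positivity
  obtain ⟨δ, hδ, hδρ, hsmall⟩ := dn_poly_small D ρ hρ0 η hη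
  obtain ⟨K, hK, hKm⟩ := dn_mahler n (Real.sqrt δ) (Real.sqrt_pos.2 hδ)
  refine ⟨K, hK, ?_⟩
  have hm := hmark f hfcont δ ρ (ENNReal.ofReal η) (by
      intro W z r hr hx
      obtain ⟨p, hpd, hp⟩ := hD W
      have hp' : ∀ t, f W t = p.eval t := hp
      rw [← ENNReal.ofReal_mul hη.le]
      refine le_trans (measure_mono ?_) (hsmall p hpd z r hr ?_)
      · rintro x ⟨hx1, hx2⟩
        refine ⟨hx1, ?_⟩
        rw [← hp', abs_of_pos (hfpos W x)]; exact hx2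
      · obtain ⟨x, hx1, hx2⟩ := hx
        exact ⟨x, hx1, by rwa [← hp']⟩)
    (fun x => dn_psi_finite (h x) (hdet x) ρ) (Finset.range (n + 1)) (by simp) Set.univ
    (fun W _ => by
      have := Submodule.finrank_le W
      simp only [Module.finrank_fin_fun] at this
      simp only [Finset.mem_range]; omega)
  have hbound : ∀ T : ℝ, 0 < T →
      (volume {t : ℝ | t ∈ Set.Icc 0 T ∧ u t • (g : SL(n, ℝ) ⧸ SLZ n) ∉ K}).toReal / T ≤ ε / 2 := by
    intro T hT
    have hball : Metric.closedBall (T / 2) (T / 2) = Set.Icc 0 T := by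
      rw [Real.closedBall_eq_Icc]; congr 1 <;> ring
    have h1 := hm (T / 2) (T / 2) (by positivity) (fun W _ => ⟨0, by
      rw [hball]; exact ⟨le_rfl, hT.le⟩, hρf W⟩)
    rw [hball] at h1
    have h2 : volume {t : ℝ | t ∈ Set.Icc 0 T ∧ u t • (g : SL(n, ℝ) ⧸ SLZ n) ∉ K} ≤
        C * ENNReal.ofReal η * ENNReal.ofReal (T / 2) := by
      refine le_trans (measure_mono ?_) h1
      rintro t ⟨ht1, ht2⟩
      refine ⟨ht1, fun hmk => ht2 ?_⟩
      refine hKm (u t * g) fun v hv => ?_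
      have := dn_marked_bound h t (hdet t) δ ρ hδρ hρ1 hmk v hv
      exact Real.sqrt_le_iff.2 ⟨norm_nonneg _, this⟩
    have h3 := ENNReal.toReal_mono (by finiteness) h2
    rw [ENNReal.toReal_mul, ENNReal.toReal_mul, ENNReal.toReal_ofReal hη.le,
      ENNReal.toReal_ofReal (by positivity)] at h3
    rw [div_le_iff₀ hT]
    refine h3.trans ?_
    have hC0 : 0 ≤ C.toReal := ENNReal.toReal_nonneg
    have h4 : C.toReal * η ≤ ε := by
      change C.toReal * (ε / (C.toReal + 1)) ≤ ε
      rw [mul_div_assoc', div_le_iff₀ (by positivity)]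
      nlinarith
    nlinarith
  refine lt_of_le_of_lt (Filter.limsup_le_of_le ?_ ?_) (half_lt_self hε)
  · refine isCoboundedUnder_le_of_eventually_le (x := 0) _ ?_
    filter_upwards [eventually_gt_atTop 0] with T hT
    positivity
  · filter_upwards [eventually_gt_atTop 0] with T hT
    exact hbound T hT
end
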